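/- arXiv:2102.11365 — 9 statements merged into one kernel-verified Lean document; each statement's English description precedes it below -/
import Mathlib

section
/- Let (X,d) be a pseudometric space and let μ be a nonnegative measure defined on (a σ-algebra containing) the ball σ-algebra of X. Then the support spt(μ) := {x ∈ X : μ(B(x,r)) > 0 for every r > 0} is a closed subset of X. Moreover, if μ is σ-finite, then spt(μ) is separable, and consequently spt(μ) belongs to the ball σ-algebra of X. -/
open MeasureTheory Metric

/-- The ball σ-algebra of a pseudometric space: the σ-algebra generated by the open balls. -/
def ballSigmaAlgebra (X : Type*) [PseudoMetricSpace X] : MeasurableSpace X :=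
  MeasurableSpace.generateFrom {s : Set X | ∃ (x : X) (r : ℝ), s = Metric.ball x r}

theorem measurableSet_ballSigmaAlgebra_ball {X : Type*} [PseudoMetricSpace X] (x : X) (r : ℝ) :
    MeasurableSet[ballSigmaAlgebra X] (ball x r) :=
  MeasurableSpace.measurableSet_generateFrom ⟨x, r, rfl⟩

/-- A closed separable set belongs to the ball σ-algebra. -/
theorem IsClosed.measurableSet_ballSigmaAlgebra {X : Type*} [PseudoMetricSpace X] {s : Set X}
    (hs : IsClosed s) (hsep : TopologicalSpace.IsSeparable s) :
    MeasurableSet[ballSigmaAlgebra X] s := by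
  obtain ⟨t, hts, htc, hst⟩ := hsep.exists_countable_dense_subset
  have hs_eq : s = ⋂ n : ℕ, ⋃ y ∈ t, ball y (1 / ((n : ℝ) + 1)) := by
    have hcl : s = closure t := hst.antisymm (hs.closure_subset_iff.2 hts)
    ext x
    rw [hcl, Metric.mem_closure_iff]
    simp only [Set.mem_iInter, Set.mem_iUnion, mem_ball, exists_prop]
    constructor
    · exact fun h n => h _ Nat.one_div_pos_of_nat
    · intro h ε hε
      obtain ⟨n, hn⟩ := exists_nat_one_div_lt hε
      obtain ⟨y, hy, hxy⟩ := h n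
      exact ⟨y, hy, hxy.trans hn⟩
  rw [hs_eq]
  exact MeasurableSet.iInter fun _ =>
    MeasurableSet.biUnion htc fun _ _ => measurableSet_ballSigmaAlgebra_ball _ _

theorem Metric.exists_maximal_isSeparated {X : Type*} [PseudoEMetricSpace X] (ε : ENNReal)
    (s : Set X) : ∃ t, Maximal (fun t => t ⊆ s ∧ IsSeparated ε t) t := by
  refine zorn_subset {t | t ⊆ s ∧ IsSeparated ε t} fun c hc hchain => ?_
  exact ⟨⋃₀ c, ⟨Set.sUnion_subset fun t ht => (hc ht).1,
    hchain.pairwise_sUnion.2 fun t ht => (hc ht).2⟩, fun t ht => Set.subset_sUnion_of_mem ht⟩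

theorem isClosed_setOf_forall_measure_ball_pos {X : Type*} [PseudoMetricSpace X]
    {mX : MeasurableSpace X} (μ : Measure X) :
    IsClosed {x : X | ∀ r : ℝ, 0 < r → 0 < μ (ball x r)} := by
  refine isClosed_of_closure_subset fun x hx r hr => ?_
  obtain ⟨y, hy, hxy⟩ := Metric.mem_closure_iff.1 hx (r / 2) (half_pos hr)
  refine (hy (r / 2) (half_pos hr)).trans_le (measure_mono (ball_subset_ball' ?_))
  rw [dist_comm]
  linarith

/-- For an s-finite measure, a separated set of centers of balls of positive measure is
countable. -/
theorem Metric.IsSeparated.countable_of_measure_ball_pos {X : Type*} [PseudoMetricSpace X]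
    {mX : MeasurableSpace X} (hball : ballSigmaAlgebra X ≤ mX) (μ : Measure X) [SFinite μ]
    {ε : NNReal} {t : Set X} (ht : IsSeparated ε t)
    (hpos : ∀ x ∈ t, 0 < μ (ball x (ε / 2))) : t.Countable := by
  have hdisj : Pairwise (Function.onFun Disjoint fun x : t => ball (x : X) ((ε : ℝ) / 2)) := by
    intro x y hxy
    refine ball_disjoint_ball ?_
    have h : (ε : ENNReal) < edist (x : X) y := ht x.2 y.2 (Subtype.coe_injective.ne hxy)
    rw [edist_nndist, ENNReal.coe_lt_coe, ← NNReal.coe_lt_coe, coe_nndist] at h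
    linarith
  have hcount := Measure.countable_meas_pos_of_disjoint_iUnion (μ := μ)
    (fun x : t => hball _ (measurableSet_ballSigmaAlgebra_ball (x : X) ((ε : ℝ) / 2))) hdisj
  have huniv : {x : t | 0 < μ (ball (x : X) ((ε : ℝ) / 2))} = Set.univ :=
    Set.eq_univ_of_forall fun x => hpos x x.2
  rw [huniv, Set.countable_univ_iff] at hcount
  exact Set.countable_coe_iff.1 hcount

theorem isSeparable_setOf_forall_measure_ball_pos {X : Type*} [PseudoMetricSpace X]
    {mX : MeasurableSpace X} (hball : ballSigmaAlgebra X ≤ mX) (μ : Measure X) [SFinite μ] :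
    TopologicalSpace.IsSeparable {x : X | ∀ r : ℝ, 0 < r → 0 < μ (ball x r)} := by
  obtain ⟨t, -, htc, hst⟩ := EMetric.subset_countable_closure_of_almost_dense_set
    {x : X | ∀ r : ℝ, 0 < r → 0 < μ (ball x r)} fun ε hε => by
      obtain ⟨δ, hδ, hδε⟩ := ENNReal.lt_iff_exists_nnreal_btwn.1 hε
      obtain ⟨t, ht⟩ := exists_maximal_isSeparated δ
        {x : X | ∀ r : ℝ, 0 < r → 0 < μ (ball x r)}
      have hδ_pos : (0 : ℝ) < δ := mod_cast hδ
      refine ⟨t, ht.prop.2.countable_of_measure_ball_pos hball μ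
        fun x hx => ht.prop.1 hx _ (half_pos hδ_pos), ?_⟩
      exact (isCover_iff_subset_iUnion_closedEBall.1 (.of_maximal_isSeparated ht)).trans
        (Set.iUnion₂_mono fun _ _ => closedEBall_subset_closedEBall hδε.le)
  exact ⟨t, htc, hst⟩

/-- Let `(X,d)` be a pseudometric space and `μ` a nonnegative measure on a
σ-algebra containing the ball σ-algebra. Then `spt μ = {x | ∀ r > 0, μ (B(x,r)) > 0}` is closed;
moreover, if `μ` is σ-finite, then `spt μ` is separable and belongs to the ball σ-algebra. -/
theorem stmt0 {X : Type*} [PseudoMetricSpace X] {mX : MeasurableSpace X}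
    (hball : ballSigmaAlgebra X ≤ mX) (μ : Measure X) :
    IsClosed {x : X | ∀ r : ℝ, 0 < r → 0 < μ (Metric.ball x r)} ∧
    (SigmaFinite μ →
      TopologicalSpace.IsSeparable {x : X | ∀ r : ℝ, 0 < r → 0 < μ (Metric.ball x r)} ∧
      MeasurableSet[ballSigmaAlgebra X]
        {x : X | ∀ r : ℝ, 0 < r → 0 < μ (Metric.ball x r)}) := by
  refine ⟨isClosed_setOf_forall_measure_ball_pos μ, fun _ => ?_⟩
  have hsep := isSeparable_setOf_forall_measure_ball_pos hball μ
  exact ⟨hsep, (isClosed_setOf_forall_measure_ball_pos μ).measurableSet_ballSigmaAlgebra hsep⟩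
end

section
/- Let (X,d) be a pseudometric space and let C ⊆ X be a closed and separable subset. Then C belongs to the ball σ-algebra of X; in fact, for any sequence (x_n) that is dense in C one has C = ⋂_{k∈ℕ} ⋃_{n∈ℕ} B(x_n, 1/k). -/
open Metric MeasureTheory

/-- A closed set is the intersection of the `1/(k+1)`-thickenings of any sequence dense in it. -/
theorem IsClosed.eq_iInter_iUnion_ball {X : Type*} [PseudoMetricSpace X] {C : Set X}
    (hC : IsClosed C) {x : ℕ → X} (hx : ∀ n, x n ∈ C) (hd : C ⊆ closure (Set.range x)) :
    C = ⋂ k : ℕ, ⋃ n : ℕ, Metric.ball (x n) (1 / ((k : ℝ) + 1)) := by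
  ext y
  simp only [Set.mem_iInter, Set.mem_iUnion, Metric.mem_ball]
  constructor
  · intro hy k
    exact Metric.mem_closure_range_iff.1 (hd hy) _ Nat.one_div_pos_of_nat
  · intro h
    rw [← hC.closure_eq]
    refine Metric.mem_closure_iff.2 fun ε hε => ?_
    obtain ⟨k, hk⟩ := exists_nat_one_div_lt hε
    obtain ⟨n, hn⟩ := h k
    exact ⟨x n, hx n, hn.trans hk⟩

/-- In a pseudometric space, every closed separable subset `C` belongs to the
ball σ-algebra; in fact, for every sequence `(x n)` dense in `C` one has
`C = ⋂ k, ⋃ n, B(x n, 1/(k+1))`. -/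
theorem stmt1 {X : Type*} [PseudoMetricSpace X] (C : Set X) (hC : IsClosed C)
    (hsep : TopologicalSpace.IsSeparable C) :
    MeasurableSet[ballSigmaAlgebra X] C ∧
    ∀ x : ℕ → X, (∀ n, x n ∈ C) → C ⊆ closure (Set.range x) →
      C = ⋂ k : ℕ, ⋃ n : ℕ, Metric.ball (x n) (1 / ((k : ℝ) + 1)) := by
  refine ⟨?_, fun x hx hd => hC.eq_iInter_iUnion_ball hx hd⟩
  rcases C.eq_empty_or_nonempty with rfl | hne
  · exact @MeasurableSet.empty X (ballSigmaAlgebra X)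
  obtain ⟨s, hsC, hs, hCs⟩ := hsep.exists_countable_dense_subset
  obtain ⟨x, rfl⟩ := hs.exists_eq_range (closure_nonempty_iff.1 (hne.mono hCs))
  rw [hC.eq_iInter_iUnion_ball (fun n => hsC (Set.mem_range_self n)) hCs]
  exact MeasurableSet.iInter fun k => MeasurableSet.iUnion fun n =>
    MeasurableSpace.measurableSet_generateFrom ⟨x n, _, rfl⟩
end

section
/- Let (X,d_X,p_X) and (Y,d_Y,p_Y) be pointed Polish metric spaces, and let ψ : X → Y be an (R,ε)-approximation for some R,ε > 0 with 4ε < R. Then there exists an (R−ε,3ε)-approximation φ : Y → X (called a quasi-inverse of ψ) such that d_X(x, φ(ψ(x))) < 3ε for every x ∈ B(p_X, R−4ε), and d_Y(y, ψ(φ(y))) < 3ε for every y ∈ B(p_Y, R−ε). -/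
open Metric

/-- An `(R,ε)`-approximation between pointed metric spaces: a Borel map `ψ` sending `pX` to `pY`,
almost preserving distances on the ball `B(pX,R)`, and such that `B(pY,R-ε)` is contained in the
open `ε`-neighbourhood of `ψ(B(pX,R))`. -/
def IsApprox {X Y : Type*} [MetricSpace X] [MetricSpace Y]
    (pX : X) (pY : Y) (R ε : ℝ) (ψ : X → Y) : Prop :=
  @Measurable X Y (borel X) (borel Y) ψ ∧ ψ pX = pY ∧
    (∀ x ∈ Metric.ball pX R, ∀ y ∈ Metric.ball pX R,
      |dist x y - dist (ψ x) (ψ y)| ≤ ε) ∧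
    Metric.ball pY (R - ε) ⊆ Metric.thickening ε (ψ '' Metric.ball pX R)

/-- For a separable target, the points of the open `ε`-neighbourhood of `f '' s` are `ε`-close to
the image of a sequence in `s`, which may be chosen to start at a given point of `s`. -/
theorem exists_seq_dist_lt_of_mem_thickening {X Y : Type*} [PseudoMetricSpace Y]
    [TopologicalSpace.SeparableSpace Y] (f : X → Y) {s : Set X} {p : X} (hp : p ∈ s) (ε : ℝ) :
    ∃ u : ℕ → X, u 0 = p ∧ (∀ n, u n ∈ s) ∧
      ∀ y ∈ Metric.thickening ε (f '' s), ∃ n, dist y (f (u n)) < ε := by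
  have : SecondCountableTopology Y := UniformSpace.secondCountable_of_separable Y
  have : Nonempty (f '' s) := ⟨⟨f p, p, hp, rfl⟩⟩
  choose v hvs hv using fun n => (TopologicalSpace.denseSeq (f '' s) n).2
  refine ⟨fun n => n.casesOn p v, rfl, fun n => ?_, fun y hy => ?_⟩
  · cases n with
    | zero => exact hp
    | succ n => exact hvs n
  · obtain ⟨z, hz, hyz⟩ := Metric.mem_thickening_iff.1 hy
    obtain ⟨n, hn⟩ := (TopologicalSpace.denseRange_denseSeq (f '' s)).exists_dist_lt
      (⟨z, hz⟩ : f '' s) (sub_pos.2 hyz)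
    refine ⟨n + 1, ?_⟩
    have hzn : dist z (f (v n)) < ε - dist y z := by rw [hv n]; exact hn
    change dist y (f (v n)) < ε
    linarith [dist_triangle y z (f (v n))]

/-- If every point of the measurable set `t` is `ε`-close to `f '' s`, then `f` has a Borel
approximate right inverse on `t` with values in `s`, sending `f p` to `p`. -/
theorem exists_measurable_dist_lt {X Y : Type*} [MeasurableSpace X] [PseudoMetricSpace Y]
    [MeasurableSpace Y] [OpensMeasurableSpace Y] [TopologicalSpace.SeparableSpace Y]
    (f : X → Y) {s : Set X} {p : X} (hp : p ∈ s) {ε : ℝ} (hε : 0 < ε) {t : Set Y}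
    (ht : MeasurableSet t) (hts : t ⊆ Metric.thickening ε (f '' s)) :
    ∃ g : Y → X, Measurable g ∧ g (f p) = p ∧ (∀ y, g y ∈ s) ∧
      ∀ y ∈ t, dist y (f (g y)) < ε := by
  classical
  obtain ⟨u, hu0, hus, hu⟩ := exists_seq_dist_lt_of_mem_thickening f hp ε
  have hex : ∀ y, ∃ n, y ∈ t → dist y (f (u n)) < ε := fun y => by
    by_cases hy : y ∈ t
    · obtain ⟨n, hn⟩ := hu y (hts hy)
      exact ⟨n, fun _ => hn⟩
    · exact ⟨0, fun h => absurd h hy⟩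
  refine ⟨fun y => u (Nat.find (hex y)), ?_, ?_, fun y => hus _, fun y => Nat.find_spec (hex y)⟩
  · refine measurable_from_nat.comp (measurable_find hex fun n => ?_)
    have hset : {y | y ∈ t → dist y (f (u n)) < ε} = tᶜ ∪ Metric.ball (f (u n)) ε := by
      ext y
      simp [imp_iff_not_or]
    rw [hset]
    exact ht.compl.union Metric.isOpen_ball.measurableSet
  · have h0 : Nat.find (hex (f p)) = 0 := by
      rw [Nat.find_eq_zero, hu0, dist_self]
      exact fun _ => hε
    simp only [h0, hu0]

/-- Every `(R,ε)`-approximation `ψ` with `4ε < R` between pointed Polish metric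
spaces admits a quasi-inverse: an `(R-ε,3ε)`-approximation `φ` with
`dist x (φ(ψ x)) < 3ε` on `B(pX,R-4ε)` and `dist y (ψ(φ y)) < 3ε` on `B(pY,R-ε)`. -/
theorem stmt2 {X Y : Type*} [MetricSpace X] [MetricSpace Y]
    [CompleteSpace X] [TopologicalSpace.SeparableSpace X]
    [CompleteSpace Y] [TopologicalSpace.SeparableSpace Y]
    (pX : X) (pY : Y) (R ε : ℝ) (hε : 0 < ε) (hR : 4 * ε < R)
    (ψ : X → Y) (hψ : IsApprox pX pY R ε ψ) :
    ∃ φ : Y → X, IsApprox pY pX (R - ε) (3 * ε) φ ∧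
      (∀ x ∈ Metric.ball pX (R - 4 * ε), dist x (φ (ψ x)) < 3 * ε) ∧
      (∀ y ∈ Metric.ball pY (R - ε), dist y (ψ (φ y)) < 3 * ε) := by
  obtain ⟨-, hp, hdist, hcov⟩ := hψ
  let _ : MeasurableSpace X := borel X
  let _ : MeasurableSpace Y := borel Y
  have : BorelSpace Y := ⟨rfl⟩
  have hpX : pX ∈ Metric.ball pX R := Metric.mem_ball_self (by linarith)
  obtain ⟨φ, hφm, hφp, hφmem, hφ⟩ :=
    exists_measurable_dist_lt ψ hpX hε Metric.isOpen_ball.measurableSet hcov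
  have hψball : ∀ x ∈ Metric.ball pX (R - 4 * ε), ψ x ∈ Metric.ball pY (R - ε) := by
    intro x hx
    rw [Metric.mem_ball] at hx ⊢
    have h := abs_le.1 (hdist x (Metric.mem_ball.2 (by linarith)) pX hpX)
    rw [hp] at h
    linarith [h.1]
  have hφψ : ∀ x ∈ Metric.ball pX (R - 4 * ε), dist x (φ (ψ x)) < 3 * ε := by
    intro x hx
    have h := abs_le.1 (hdist x (Metric.ball_subset_ball (by linarith) hx) _ (hφmem (ψ x)))
    linarith [h.2, hφ _ (hψball x hx)]
  refine ⟨φ, ⟨hφm, hp ▸ hφp, fun y hy z hz => ?_, fun x hx => ?_⟩, hφψ,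
    fun y hy => by linarith [hφ y hy]⟩
  · have h := abs_le.1 (hdist _ (hφmem y) _ (hφmem z))
    have hyz := abs_le.1 (dist_dist_dist_le y z (ψ (φ y)) (ψ (φ z)))
    rw [abs_le]
    constructor <;> linarith [h.1, h.2, hyz.1, hyz.2, hφ y hy, hφ z hz]
  · have hx' : x ∈ Metric.ball pX (R - 4 * ε) := Metric.ball_subset_ball (by linarith) hx
    exact Metric.mem_thickening_iff.2 ⟨_, ⟨ψ x, hψball x hx', rfl⟩, hφψ x hx'⟩
end

section
/- Let (X,d_X,p_X) and (Y,d_Y,p_Y) be pointed Polish metric spaces and let R,r,r',ε > 0 satisfy r + r' < R − 3ε and r > 3ε. Let ψ : X → Y be an (R,ε)-approximation mapping X ∖ B(p_X,R) into Y ∖ B(p_Y,R), and let φ : Y → X be a quasi-inverse of ψ, i.e. an (R−ε,3ε)-approximation such that d_X(x, φ(ψ(x))) < 3ε for all x ∈ B(p_X,R−4ε) and d_Y(y, ψ(φ(y))) < 3ε for all y ∈ B(p_Y,R−ε). Then for every point y ∈ B(p_Y,r'): (a) B(y, r−3ε) is contained in the open 3ε-neighbourhood of ψ(B(φ(y),r));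 and (b) ψ^{-1}(B(y, r−3ε)) ⊆ B(φ(y), r+4ε). -/
open Metric

/-- If `ψ` is an `(R,ε)`-approximation mapping the complement of `B(pX,R)` into
the complement of `B(pY,R)` and `φ` is a quasi-inverse of `ψ`, then for `r + r' < R - 3ε`,
`r > 3ε` and every `y ∈ B(pY,r')`:
(a) `B(y,r-3ε)` is contained in the open `3ε`-neighbourhood of `ψ(B(φ y, r))`;
(b) `ψ⁻¹(B(y,r-3ε)) ⊆ B(φ y, r+4ε)`. -/
theorem stmt3 {X Y : Type*} [MetricSpace X] [MetricSpace Y]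
    [CompleteSpace X] [TopologicalSpace.SeparableSpace X]
    [CompleteSpace Y] [TopologicalSpace.SeparableSpace Y]
    (pX : X) (pY : Y) (R r r' ε : ℝ)
    (hε : 0 < ε) (hr : 3 * ε < r) (hr' : 0 < r') (hrr' : r + r' < R - 3 * ε)
    (ψ : X → Y) (hψ : IsApprox pX pY R ε ψ)
    (hout : ∀ x : X, x ∉ Metric.ball pX R → ψ x ∉ Metric.ball pY R)
    (φ : Y → X) (hφ : IsApprox pY pX (R - ε) (3 * ε) φ)
    (hφψ : ∀ x ∈ Metric.ball pX (R - 4 * ε), dist x (φ (ψ x)) < 3 * ε)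
    (hψφ : ∀ y ∈ Metric.ball pY (R - ε), dist y (ψ (φ y)) < 3 * ε) :
    ∀ y ∈ Metric.ball pY r',
      Metric.ball y (r - 3 * ε) ⊆ Metric.thickening (3 * ε) (ψ '' Metric.ball (φ y) r) ∧
      ψ ⁻¹' (Metric.ball y (r - 3 * ε)) ⊆ Metric.ball (φ y) (r + 4 * ε) := by
  obtain ⟨-, -, hψdist, -⟩ := hψ
  obtain ⟨-, hφp, hφdist, -⟩ := hφ
  simp only [mem_ball] at hψdist hφdist hout hψφ
  intro y hy
  rw [mem_ball] at hy
  have hyR : dist y pY < R - ε := by linarith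
  refine ⟨fun z hz => ?_, fun x hx => ?_⟩
  · rw [mem_ball] at hz
    have hzR : dist z pY < R - ε := by linarith [dist_triangle z y pY]
    have hφzy := (abs_le.mp (hφdist z hzR y hyR)).1
    refine mem_thickening_iff.mpr ⟨ψ (φ z), Set.mem_image_of_mem ψ ?_, hψφ z hzR⟩
    rw [mem_ball]
    linarith
  · rw [Set.mem_preimage, mem_ball] at hx
    have hxR : dist x pX < R := by
      by_contra h
      exact hout x h (by linarith [dist_triangle (ψ x) y pY])
    have hφyR : dist (φ y) pX < R := by
      have h := (abs_le.mp (hφdist y hyR pY (by rw [dist_self]; linarith))).1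
      rw [hφp] at h
      linarith
    have hxy := (abs_le.mp (hψdist x hxR (φ y) hφyR)).2
    rw [mem_ball]
    linarith [dist_triangle (ψ x) y (ψ (φ y)), hψφ y hyR]
end

section
/- Let ((X_i,d_i,p_i))_{i∈ℕ} and (X_∞,d_∞,p_∞) be pointed Polish metric spaces, and suppose ψ_i : X_i → X_∞ are (R_i,ε_i)-approximations with R_i ↗ +∞ and ε_i ↘ 0. Let m_∞ be a Borel probability measure on X_∞. Then there exist Borel probability measures m_i on X_i (i ∈ ℕ) such that (ψ_i)_* m_i converges weakly to m_∞ in duality with C_bbs(X_∞). -/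
open Metric MeasureTheory Filter Topology

/-- A family of open sets in a second countable space admits a measurable selection on its union:
there is a measurable `T` with `y ∈ S (T y)` whenever `y` lies in some member of the family. -/
theorem exists_measurable_selection_iUnion_isOpen {X Y : Type*} [MeasurableSpace X] [Nonempty X]
    [TopologicalSpace Y] [SecondCountableTopology Y] [MeasurableSpace Y] [BorelSpace Y]
    (S : X → Set Y) (hS : ∀ z, IsOpen (S z)) :
    ∃ T : Y → X, Measurable T ∧ ∀ y ∈ ⋃ z, S z, y ∈ S (T y) := by
  classical
  obtain ⟨c, hc, hcover⟩ := TopologicalSpace.isOpen_iUnion_countable S hS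
  obtain rfl | hne := c.eq_empty_or_nonempty
  · refine ⟨fun _ => Classical.arbitrary X, measurable_const, fun y hy => ?_⟩
    simp [← hcover] at hy
  obtain ⟨x, rfl⟩ := hc.exists_eq_range hne
  have hex : ∀ y, ∃ n, y ∈ S (x n) ∪ (⋃ z, S z)ᶜ := by
    intro y
    by_cases hy : y ∈ ⋃ z, S z
    · rw [← hcover] at hy
      simp only [Set.mem_range, Set.iUnion_exists, Set.iUnion_iUnion_eq', Set.mem_iUnion] at hy
      exact hy.imp fun n hn => Or.inl hn
    · exact ⟨0, Or.inr hy⟩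
  refine ⟨fun y => x (Nat.find (hex y)), ?_, fun y hy => ?_⟩
  · exact (measurable_from_nat (f := x)).comp <| measurable_find hex fun n =>
      (hS (x n)).measurableSet.union (isOpen_iUnion hS).measurableSet.compl
  · exact (Nat.find_spec (hex y)).resolve_right fun h => h hy

/-- Given pointed Polish metric spaces `(X i, p i)` pGH-converging to `(Y, q)`
via `(R i, ε i)`-approximations `ψ i`, and a Borel probability measure `mlim` on `Y`, there exist
Borel probability measures `m i` on `X i` such that `(ψ i)_* (m i)` converges weakly to `mlim`
in duality with `C_bbs(Y)`. -/
theorem stmt4 {X : ℕ → Type*} [∀ i, MetricSpace (X i)] [∀ i, CompleteSpace (X i)]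
    [∀ i, TopologicalSpace.SeparableSpace (X i)]
    [∀ i, MeasurableSpace (X i)] [∀ i, BorelSpace (X i)]
    {Y : Type*} [MetricSpace Y] [CompleteSpace Y] [TopologicalSpace.SeparableSpace Y]
    [MeasurableSpace Y] [BorelSpace Y]
    (p : ∀ i, X i) (q : Y) (R ε : ℕ → ℝ) (ψ : ∀ i, X i → Y)
    (hRmono : Monotone R) (hRtop : Tendsto R atTop atTop)
    (hεanti : Antitone ε) (hε0 : Tendsto ε atTop (nhds 0)) (hεpos : ∀ i, 0 < ε i)
    (hεR : ∀ i, ε i < R i)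
    (happrox : ∀ i, IsApprox (p i) q (R i) (ε i) (ψ i))
    (mlim : Measure Y) (hmlim : IsProbabilityMeasure mlim) :
    ∃ m : ∀ i, Measure (X i), (∀ i, IsProbabilityMeasure (m i)) ∧
      ∀ f : Y → ℝ, Continuous f → (∃ C : ℝ, ∀ y, |f y| ≤ C) →
        Bornology.IsBounded (Function.support f) →
        Tendsto (fun i => ∫ y, f y ∂((m i).map (ψ i))) atTop (nhds (∫ y, f y ∂mlim)) := by
  have : SecondCountableTopology Y := UniformSpace.secondCountable_of_separable Y
  have hψ (i : ℕ) : Measurable (ψ i) := by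
    have h := (happrox i).1
    rwa [← BorelSpace.measurable_eq (α := X i), ← BorelSpace.measurable_eq (α := Y)] at h
  have hsel (i : ℕ) : ∃ T : Y → X i, Measurable T ∧
      ∀ y ∈ ball q (R i - ε i), dist y (ψ i (T y)) < ε i := by
    have : Nonempty (X i) := ⟨p i⟩
    obtain ⟨T, hT, hTS⟩ := exists_measurable_selection_iUnion_isOpen
      (fun z => ball (ψ i z) (ε i)) fun z => isOpen_ball
    refine ⟨T, hT, fun y hy => hTS y ?_⟩
    obtain ⟨_, ⟨z, _, rfl⟩, hz⟩ := mem_thickening_iff.1 ((happrox i).2.2.2 hy)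
    exact Set.mem_iUnion.2 ⟨z, hz⟩
  choose T hT hTdist using hsel
  refine ⟨fun i => mlim.map (T i), fun i => Measure.isProbabilityMeasure_map (hT i).aemeasurable,
    fun f hf hfb _ => ?_⟩
  obtain ⟨C, hC⟩ := hfb
  have hmap (i : ℕ) : ∫ y, f y ∂((mlim.map (T i)).map (ψ i)) = ∫ y, f (ψ i (T i y)) ∂mlim := by
    rw [Measure.map_map (hψ i) (hT i),
      integral_map ((hψ i).comp (hT i)).aemeasurable hf.aestronglyMeasurable]
    rfl
  simp only [hmap]
  refine tendsto_integral_of_dominated_convergence (fun _ => C)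
    (fun i => (hf.measurable.comp ((hψ i).comp (hT i))).aestronglyMeasurable)
    (integrable_const C) (fun i => Eventually.of_forall fun y => hC _)
    (Eventually.of_forall fun y => (hf.tendsto y).comp ?_)
  have hradius : Tendsto (fun i => R i - ε i) atTop atTop := by
    simpa only [sub_eq_add_neg] using hRtop.atTop_add hε0.neg
  rw [tendsto_iff_dist_tendsto_zero]
  refine squeeze_zero' (Eventually.of_forall fun i => dist_nonneg) ?_ hε0
  filter_upwards [hradius.eventually_gt_atTop (dist y q)] with i hi
  rw [dist_comm]
  exact (hTdist i y hi).le
end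

section
/- Let (X,d_X,m_X,p_X) and (Y,d_Y,m_Y,p_Y) be pointed Polish metric measure spaces with boundedly finite measures, and let ψ : X → Y be a weak (R,ε)-approximation with associated Borel set X̃ ⊆ B(p_X,R), for some R,ε > 0 with 4ε < R. Then there exists a weak (R−ε,3ε)-approximation φ : Y → X (a rough inverse of ψ), with associated set Ỹ := ψ(X̃)^ε ∩ B(p_Y,R−ε), such that d_X(x, φ(ψ(x))) < 3ε for every x ∈ B(p_X, R−4ε) ∩ X̃, and d_Y(y, ψ(φ(y))) < 3ε for every y ∈ B(p_Y, R−ε) ∩ Ỹ. -/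
open Metric MeasureTheory
open scoped ENNReal

/-- A weak `(R,ε)`-approximation between pointed Polish metric measure spaces, witnessed by the
Borel set `T ⊆ B(pX,R)`: a Borel map `ψ` with `ψ pX = pY`, almost preserving distances on `T`,
with `mX (B(pX,R) \ T) ≤ ε` and `mY (B(pY,R-ε) \ ψ(T)^ε) ≤ ε`. -/
def IsWeakApproxOn {X Y : Type*} [MetricSpace X] [MetricSpace Y]
    [MeasurableSpace X] [MeasurableSpace Y]
    (mX : Measure X) (mY : Measure Y) (pX : X) (pY : Y) (R ε : ℝ)
    (ψ : X → Y) (T : Set X) : Prop :=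
  Measurable ψ ∧ ψ pX = pY ∧ MeasurableSet T ∧ T ⊆ Metric.ball pX R ∧ pX ∈ T ∧
    (∀ x ∈ T, ∀ y ∈ T,
      dist x y - ε ≤ dist (ψ x) (ψ y) ∧ dist (ψ x) (ψ y) ≤ dist x y + ε) ∧
    mX (Metric.ball pX R \ T) ≤ ENNReal.ofReal ε ∧
    mY (Metric.ball pY (R - ε) \ Metric.thickening ε (ψ '' T)) ≤ ENNReal.ofReal ε

/-- A map `f : X → Y` into a separable metric space has, over any set `T` with a marked point `x₀`,
a measurable `ε`-almost right inverse defined on the `ε`-neighbourhood of `f '' T`, valued in `T`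
and sending `f x₀` back to `x₀`. -/
theorem exists_measurable_approx_rightInverse {X Y : Type*} [MeasurableSpace X]
    [PseudoMetricSpace Y] [TopologicalSpace.SeparableSpace Y] [MeasurableSpace Y]
    [OpensMeasurableSpace Y] (f : X → Y) {T : Set X} {x₀ : X} (hx₀ : x₀ ∈ T)
    {ε : ℝ} (hε : 0 < ε) :
    ∃ g : Y → X, Measurable g ∧ g (f x₀) = x₀ ∧ (∀ y, g y ∈ T) ∧
      ∀ y ∈ Metric.thickening ε (f '' T), dist y (f (g y)) < ε := by
  classical
  have : SecondCountableTopology Y := UniformSpace.secondCountable_of_separable Y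
  have : Nonempty (f '' T) := ⟨⟨f x₀, x₀, hx₀, rfl⟩⟩
  have hpre : ∀ z : f '' T, ∃ x ∈ T, f x = z := fun z => z.2
  choose s hsT hs using hpre
  let u : ℕ → X := fun n => Nat.casesOn n x₀ fun k => s (TopologicalSpace.denseSeq (f '' T) k)
  have huT : ∀ n, u n ∈ T := by
    rintro (_ | k)
    · exact hx₀
    · exact hsT _
  have hex : ∀ y, ∃ n, y ∈ Metric.thickening ε (f '' T) → dist y (f (u n)) < ε := by
    intro y
    by_cases hy : y ∈ Metric.thickening ε (f '' T)
    · obtain ⟨z, hz, hyz⟩ := Metric.mem_thickening_iff.1 hy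
      obtain ⟨k, hk⟩ := (TopologicalSpace.denseRange_denseSeq (f '' T)).exists_dist_lt
        ⟨z, hz⟩ (sub_pos.2 hyz)
      refine ⟨k + 1, fun _ => ?_⟩
      have hu : f (u (k + 1)) = TopologicalSpace.denseSeq (f '' T) k := hs _
      have hk' : dist z (TopologicalSpace.denseSeq (f '' T) k : Y) < ε - dist y z := hk
      rw [hu]
      linarith [dist_triangle y z (TopologicalSpace.denseSeq (f '' T) k : Y)]
    · exact ⟨0, fun h => absurd h hy⟩
  refine ⟨fun y => u (Nat.find (hex y)), ?_, ?_, fun y => huT _, 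
    fun y hy => Nat.find_spec (hex y) hy⟩
  · refine (measurable_from_nat (f := u)).comp (measurable_find hex fun k => ?_)
    have hset : {y | y ∈ Metric.thickening ε (f '' T) → dist y (f (u k)) < ε} =
        (Metric.thickening ε (f '' T))ᶜ ∪ Metric.ball (f (u k)) ε := by
      ext y
      simp only [Set.mem_ofPred_eq, Set.mem_union, Set.mem_compl_iff, Metric.mem_ball]
      tauto
    rw [hset]
    exact Metric.isOpen_thickening.measurableSet.compl.union Metric.isOpen_ball.measurableSet
  · have h0 : Nat.find (hex (f x₀)) = 0 :=
      (Nat.find_eq_zero _).2 fun _ => by simpa [u] using hε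
    exact congrArg u h0

/-- Every weak `(R,ε)`-approximation `ψ` (with witnessing set `T`) between
pointed Polish metric measure spaces with boundedly finite measures, with `4ε < R`, admits a
rough inverse: a weak `(R-ε,3ε)`-approximation `φ : Y → X` with witnessing set
`Ỹ = ψ(T)^ε ∩ B(pY,R-ε)` such that `dist x (φ(ψ x)) < 3ε` on `B(pX,R-4ε) ∩ T` and
`dist y (ψ(φ y)) < 3ε` on `B(pY,R-ε) ∩ Ỹ`. -/
theorem stmt10 {X Y : Type*} [MetricSpace X] [MetricSpace Y]
    [CompleteSpace X] [TopologicalSpace.SeparableSpace X]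
    [CompleteSpace Y] [TopologicalSpace.SeparableSpace Y]
    [MeasurableSpace X] [BorelSpace X] [MeasurableSpace Y] [BorelSpace Y]
    (mX : Measure X) (mY : Measure Y) (pX : X) (pY : Y)
    (hbfX : ∀ (x : X) (r : ℝ), mX (Metric.ball x r) < ⊤)
    (hbfY : ∀ (y : Y) (r : ℝ), mY (Metric.ball y r) < ⊤)
    (R ε : ℝ) (hε : 0 < ε) (hR : 4 * ε < R)
    (ψ : X → Y) (T : Set X) (hψ : IsWeakApproxOn mX mY pX pY R ε ψ T) :
    ∃ φ : Y → X,
      IsWeakApproxOn mY mX pY pX (R - ε) (3 * ε) φ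
        (Metric.thickening ε (ψ '' T) ∩ Metric.ball pY (R - ε)) ∧
      (∀ x ∈ Metric.ball pX (R - 4 * ε) ∩ T, dist x (φ (ψ x)) < 3 * ε) ∧
      (∀ y ∈ Metric.ball pY (R - ε) ∩
          (Metric.thickening ε (ψ '' T) ∩ Metric.ball pY (R - ε)),
        dist y (ψ (φ y)) < 3 * ε) := by
  obtain ⟨-, hp, -, -, hpT, hd, hmX, hmY⟩ := hψ
  obtain ⟨φ, hφ, hφp, hφT, hφd⟩ := exists_measurable_approx_rightInverse ψ hpT hε
  rw [hp] at hφp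
  have hsub : ψ '' T ⊆ Metric.thickening ε (ψ '' T) := Metric.self_subset_thickening hε _
  have hball : ∀ x ∈ Metric.ball pX (R - 4 * ε) ∩ T, ψ x ∈ Metric.ball pY (R - ε) := by
    rintro x ⟨hx, hxT⟩
    have h := (hd x hxT pX hpT).2
    rw [Metric.mem_ball] at hx ⊢
    rw [hp] at h
    linarith
  have hinv : ∀ x ∈ T, dist x (φ (ψ x)) < 3 * ε := by
    intro x hxT
    have h₁ := hφd _ (hsub ⟨x, hxT, rfl⟩)
    have h₂ := (hd x hxT _ (hφT (ψ x))).1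
    linarith
  have hle : ENNReal.ofReal ε ≤ ENNReal.ofReal (3 * ε) :=
    ENNReal.ofReal_le_ofReal (by linarith)
  refine ⟨φ, ⟨hφ, hφp, ?_, Set.inter_subset_right, ?_, ?_, ?_, ?_⟩,
    fun x hx => hinv x hx.2, fun y hy => ?_⟩
  · exact Metric.isOpen_thickening.measurableSet.inter Metric.isOpen_ball.measurableSet
  · exact ⟨hsub ⟨pX, hpT, hp⟩, Metric.mem_ball_self (by linarith)⟩
  · rintro y ⟨hy, -⟩ z ⟨hz, -⟩
    have h := hd _ (hφT y) _ (hφT z)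
    have h₁ := hφd y hy
    have h₂ := hφd z hz
    have h₃ := dist_triangle4_right y z (ψ (φ y)) (ψ (φ z))
    have h₄ := dist_triangle4_left y z (ψ (φ y)) (ψ (φ z))
    constructor <;> linarith [h.1, h.2]
  · rw [Set.sdiff_inter_self_eq_sdiff]
    exact hmY.trans hle
  · refine (measure_mono ?_).trans (hmX.trans hle)
    rintro x ⟨hx, hxφ⟩
    have hx' : x ∈ Metric.ball pX (R - 4 * ε) :=
      Metric.ball_subset_ball (by linarith) hx
    refine ⟨Metric.ball_subset_ball (by linarith) hx, fun hxT => hxφ ?_⟩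
    exact Metric.mem_thickening_iff.2 ⟨φ (ψ x),
      ⟨ψ x, ⟨hsub ⟨x, hxT, rfl⟩, hball x ⟨hx', hxT⟩⟩, rfl⟩, hinv x hxT⟩
  · linarith [hφd y hy.2.1]
end

section
/- Let (X,d) be a complete separable metric space, ω a non-principal ultrafilter on ℕ, and (μ_i)_{i∈ℕ} a sequence of nonnegative Borel measures on X whose total masses have a finite ultralimit, i.e. there exists λ ∈ [0,∞) such that for every ε > 0 the set {i : |μ_i(X) − λ| ≤ ε} belongs to ω. Then the following are equivalent: (i) for every ε > 0 there exists a Borel set T ⊆ X contained in a finite union of open balls of radius ε such that for every δ > 0 the set {i : μ_i(X ∖ T) ≤ ε + δ} belongs to ω (i.e. lim_{i→ω} μ_i(X∖T) ≤ ε); (ii) there exists a finite nonnegative Borel measure μ on X such that for every bounded continuous f : X → ℝ, the real numbers ∫ f dμ_i converge along ω to ∫ f dμ. -/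
open Metric MeasureTheory Filter Topology
open scoped ENNReal

/-- Diagonal choice along a filter finer than `atTop`. -/
lemma exists_tendsto_atTop_eventually_forall_le {l : Filter ℕ} (hl : l ≤ atTop)
    {P : ℕ → ℕ → Prop} (hP : ∀ j, ∀ᶠ i in l, P j i) :
    ∃ k : ℕ → ℕ, Tendsto k l atTop ∧ ∀ᶠ i in l, ∀ j ≤ k i, P j i := by
  classical
  have hall (n : ℕ) : ∀ᶠ i in l, ∀ j ≤ n, P j i :=
    (eventually_all_finite (Set.finite_Iic n)).2 fun j _ ↦ hP j
  refine ⟨fun i ↦ Nat.findGreatest (fun n ↦ ∀ j ≤ n, P j i) i, tendsto_atTop.2 fun n ↦ ?_, ?_⟩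
  · filter_upwards [hall n, hl (eventually_ge_atTop n)] with i hi hni
    exact Nat.le_findGreatest hni hi
  · filter_upwards [hall 0] with i hi
    exact Nat.findGreatest_spec (P := fun n ↦ ∀ j ≤ n, P j i) (Nat.zero_le i) hi

/-- A set covered by finitely many balls of radius `ε` is moved by less than `ε` by some measurable
map with finite range. -/
lemma exists_measurable_finite_range_dist_lt {X : Type*} [MetricSpace X] [MeasurableSpace X]
    [OpensMeasurableSpace X] [Nonempty X] {T : Set X} {ε : ℝ} {F : Finset X}
    (hT : T ⊆ ⋃ c ∈ F, ball c ε) :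
    ∃ p : X → X, Measurable p ∧ (Set.range p).Finite ∧ ∀ x ∈ T, dist (p x) x < ε := by
  obtain ⟨x₀⟩ := ‹Nonempty X›
  let e : ℕ → X := fun n ↦ F.toList.getD n x₀
  let p := SimpleFunc.nearestPt e F.card
  refine ⟨p, p.measurable, p.finite_range, fun x hx ↦ ?_⟩
  obtain ⟨c, hc, hxc⟩ : ∃ c ∈ F, x ∈ ball c ε := by simpa using hT hx
  obtain ⟨n, hn, rfl⟩ := List.mem_iff_getElem.1 (Finset.mem_toList.2 hc)
  have hle : edist (p x) x ≤ edist (e n) x :=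
    SimpleFunc.edist_nearestPt_le e x (by simpa using hn.le)
  have hen : e n = F.toList[n] := List.getD_eq_getElem _ _ hn
  rw [edist_dist, edist_dist, ENNReal.ofReal_le_ofReal_iff dist_nonneg, hen] at hle
  exact hle.trans_lt (by rwa [dist_comm])

/-- If the maps `p k` have finite range and move the points of `T k` by less than `ε k`, with
`ε k → 0`, then the points `p k x` with `x` in `T j` for all `j ∈ [m, k]` form a totally bounded
set. -/
lemma totallyBounded_iUnion_image_inter {X : Type*} [MetricSpace X] {T : ℕ → Set X}
    {p : ℕ → X → X} {ε : ℕ → ℝ} (hε : Antitone ε) (hε0 : Tendsto ε atTop (𝓝 0))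
    (hp : ∀ k, (Set.range (p k)).Finite) (hpT : ∀ k, ∀ x ∈ T k, dist (p k x) x < ε k) (m : ℕ) :
    TotallyBounded (⋃ k, p k '' ⋂ j ∈ Finset.Icc m k, T j) := by
  refine Metric.totallyBounded_iff.2 fun δ hδ ↦ ?_
  obtain ⟨J, hJδ, hmJ⟩ := ((hε0.eventually_lt_const (half_pos hδ)).and
    (eventually_ge_atTop m)).exists
  refine ⟨⋃ k ∈ Set.Iic J, Set.range (p k), (Set.finite_Iic J).biUnion fun k _ ↦ hp k, ?_⟩
  intro y hy
  obtain ⟨k, x, hx, rfl⟩ : ∃ k x, x ∈ (⋂ j ∈ Finset.Icc m k, T j) ∧ p k x = y := by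
    simpa only [Set.mem_iUnion, Set.mem_image] using hy
  simp only [Set.mem_iInter, Finset.mem_Icc] at hx
  rcases le_total k J with hkJ | hJk
  · exact Set.mem_biUnion (Set.mem_biUnion hkJ (Set.mem_range_self x)) (mem_ball_self hδ)
  · refine Set.mem_biUnion (Set.mem_biUnion Set.self_mem_Iic (Set.mem_range_self x)) ?_
    have h₁ := hpT k x (hx k ⟨hmJ.trans hJk, le_rfl⟩)
    have h₂ := hpT J x (hx J ⟨hmJ, hJk⟩)
    have h₃ := dist_triangle_right (p k x) (p J x) x
    have h₄ := hε hJk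
    rw [mem_ball]
    linarith

/-- A function bounded by `M` everywhere and by `η` on `G` has integral at most
`η * μ univ + M * μ Gᶜ`. -/
lemma abs_integral_le_of_forall_mem_le {X : Type*} [MeasurableSpace X] {μ : Measure X}
    [IsFiniteMeasure μ] {g : X → ℝ} {G : Set X} (hG : MeasurableSet G) {M η : ℝ}
    (hη : 0 ≤ η) (hM : ∀ x, |g x| ≤ M) (hgG : ∀ x ∈ G, |g x| ≤ η) :
    |∫ x, g x ∂μ| ≤ η * μ.real Set.univ + M * μ.real Gᶜ := by
  calc |∫ x, g x ∂μ| ≤ ∫ x, (η + Gᶜ.indicator (fun _ ↦ M) x) ∂μ := by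
        refine norm_integral_le_of_norm_le (f := g) ?_ (Eventually.of_forall fun x ↦ ?_)
        · exact (integrable_const η).add ((integrable_const M).indicator hG.compl)
        · by_cases hx : x ∈ G
          · simpa [hx] using hgG x hx
          · simpa [hx] using (hM x).trans (le_add_of_nonneg_left hη)
    _ = η * μ.real Set.univ + M * μ.real Gᶜ := by
        rw [integral_add (integrable_const η) ((integrable_const M).indicator hG.compl),
          integral_indicator_const _ hG.compl]
        simp [mul_comm]

/-- Prokhorov's theorem along an ultrafilter: finite measures of bounded mass, eventually almost
concentrated on sets covered by finitely many small balls, converge weakly. -/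
theorem exists_tendsto_finiteMeasure_of_eventually_measure_compl_le {X : Type*} [MetricSpace X]
    [CompleteSpace X] [Nonempty X] [MeasurableSpace X] [BorelSpace X] {ω : Ultrafilter ℕ}
    (hω : (ω : Filter ℕ) ≤ atTop) {ν : ℕ → FiniteMeasure X} {C : NNReal}
    (hC : ∀ᶠ i in (ω : Filter ℕ), (ν i).mass ≤ C)
    (h : ∀ η : ℝ, 0 < η → ∃ T : Set X, MeasurableSet T ∧
      (∃ F : Finset X, T ⊆ ⋃ c ∈ F, ball c η) ∧
      ∀ᶠ i in (ω : Filter ℕ), (ν i : Measure X) Tᶜ ≤ ENNReal.ofReal η) :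
    ∃ μ : FiniteMeasure X, Tendsto ν ω (𝓝 μ) := by
  let ε : ℕ → NNReal := fun j ↦ (1 / 2) ^ j
  have hεsum : Summable ε := NNReal.summable_geometric (by norm_num)
  have hεanti : Antitone (fun j ↦ (ε j : ℝ)) := fun a b hab ↦
    NNReal.coe_le_coe.2 (pow_le_pow_of_le_one (by norm_num) (by norm_num) hab)
  have hε0 : Tendsto (fun j ↦ (ε j : ℝ)) atTop (𝓝 0) :=
    NNReal.tendsto_coe.2 (NNReal.tendsto_atTop_zero_of_summable hεsum)
  choose T hTm hTF hT using fun j ↦ h (ε j) (by positivity)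
  choose F hF using hTF
  choose p hpm hpfin hpT using fun j ↦ exists_measurable_finite_range_dist_lt (hF j)
  obtain ⟨k, hk, hkT⟩ := exists_tendsto_atTop_eventually_forall_le hω hT
  simp only [ENNReal.ofReal_coe_nnreal] at hkT
  let G (m n : ℕ) : Set X := ⋂ j ∈ Finset.Icc m n, T j
  have hGm (m n : ℕ) : MeasurableSet (G m n) := Finset.measurableSet_biInter _ fun j _ ↦ hTm j
  let K (m : ℕ) : Set X := closure (⋃ n, p n '' G m n)
  have hK (m : ℕ) : IsCompact (K m) :=
    (totallyBounded_iUnion_image_inter hεanti hε0 hpfin hpT m).closure.isCompact_of_isClosed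
      isClosed_closure
  have hpK (m n : ℕ) (x : X) (hx : x ∈ G m n) : p n x ∈ K m :=
    subset_closure (Set.mem_iUnion.2 ⟨n, x, hx, rfl⟩)
  let u (m : ℕ) : NNReal := ∑' j, ε (j + m)
  have hu : Tendsto u atTop (𝓝 0) := NNReal.tendsto_sum_nat_add ε
  have hGu : ∀ᶠ i in (ω : Filter ℕ), ∀ m, (ν i : Measure X) (G m (k i))ᶜ ≤ u m := by
    filter_upwards [hkT] with i hi m
    calc (ν i : Measure X) (G m (k i))ᶜ
        ≤ ∑ j ∈ Finset.Icc m (k i), (ν i : Measure X) (T j)ᶜ := by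
          simp only [G, Set.compl_iInter]
          exact measure_biUnion_finset_le _ _
      _ ≤ ∑ j ∈ Finset.Icc m (k i), (ε j : ℝ≥0∞) :=
          Finset.sum_le_sum fun j hj ↦ hi j (Finset.mem_Icc.1 hj).2
      _ ≤ u m := by
          rw [← ENNReal.ofNNReal_finsetSum, ENNReal.coe_le_coe]
          have : Finset.Icc m (k i) ⊆ (Finset.range (k i + 1)).image (· + m) := by
            intro j hj
            rw [Finset.mem_Icc] at hj
            exact Finset.mem_image.2 ⟨j - m, by simp; omega, by omega⟩
          refine (Finset.sum_le_sum_of_subset this).trans ?_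
          rw [Finset.sum_image (by simp)]
          exact ((NNReal.summable_nat_add_iff m).2 hεsum).sum_le_tsum _ (by simp)
  let ν' (i : ℕ) : FiniteMeasure X := (ν i).map (p (k i))
  obtain ⟨μ, -, hμ⟩ := (isCompact_setOfPred_finiteMeasure_mass_le_compl_isCompact_le C hu hK
    (Or.inl inferInstance)).ultrafilter_le_nhds' (ω.map ν') (by
      rw [Ultrafilter.mem_map]
      filter_upwards [hC, hGu] with i hi hiG
      refine ⟨(FiniteMeasure.mass_map_le _ _).trans hi, fun m ↦ ?_⟩
      rw [← ENNReal.coe_le_coe, FiniteMeasure.ennreal_coeFn_eq_coeFn_toMeasure,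
        FiniteMeasure.toMeasure_map,
        Measure.map_apply (hpm _) (hK m).isClosed.measurableSet.compl]
      have hsub : p (k i) ⁻¹' (K m)ᶜ ⊆ (G m (k i))ᶜ := fun x hx hxG ↦ hx (hpK m _ x hxG)
      exact (measure_mono hsub).trans (hiG m))
  have hμ' : Tendsto ν' ω (𝓝 μ) := hμ
  refine ⟨μ, FiniteMeasure.tendsto_of_forall_integral_tendsto fun f ↦ ?_⟩
  have hν' (i : ℕ) : ∫ x, f x ∂(ν' i : Measure X) = ∫ x, f (p (k i) x) ∂(ν i : Measure X) := by
    rw [FiniteMeasure.toMeasure_map]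
    exact integral_map (hpm _).aemeasurable f.continuous.measurable.aestronglyMeasurable
  suffices hdiff : Tendsto (fun i ↦ ∫ x, f x ∂(ν i : Measure X) - ∫ x, f x ∂(ν' i : Measure X))
      ω (𝓝 0) by
    simpa using hdiff.add (FiniteMeasure.tendsto_iff_forall_integral_tendsto.1 hμ' f)
  refine Metric.tendsto_nhds.2 fun r hr ↦ ?_
  obtain ⟨m, hm⟩ : ∃ m, 2 * ‖f‖ * u m < r / 2 := by
    have : Tendsto (fun m ↦ 2 * ‖f‖ * (u m : ℝ)) atTop (𝓝 0) := by
      simpa using (NNReal.tendsto_coe.2 hu).const_mul (2 * ‖f‖)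
    exact (this.eventually_lt_const (half_pos hr)).exists
  obtain ⟨η, hη, hηC⟩ : ∃ η : ℝ, 0 < η ∧ η * C ≤ r / 2 :=
    ⟨r / 2 / (C + 1), by positivity, by
      rw [div_mul_eq_mul_div, div_le_iff₀ (by positivity)]
      gcongr
      simp⟩
  obtain ⟨δ, hδ, hfδ⟩ := Metric.mem_uniformity_dist.1
    ((hK m).uniformContinuousAt_of_continuousAt f (fun x _ ↦ f.continuous.continuousAt)
      (Metric.dist_mem_uniformity hη))
  filter_upwards [hC, hGu, (hε0.comp hk).eventually_lt_const hδ, hk.eventually_ge_atTop m]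
    with i hiC hiG hiδ him
  have hint : Integrable (fun x ↦ f (p (k i) x)) (ν i : Measure X) :=
    Integrable.of_bound (f.continuous.measurable.comp (hpm _)).aestronglyMeasurable ‖f‖
      (Eventually.of_forall fun x ↦ f.norm_coe_le_norm _)
  have hmass : (ν i : Measure X).real Set.univ ≤ C := hiC
  have hGr : (ν i : Measure X).real (G m (k i))ᶜ ≤ u m :=
    ENNReal.toReal_le_coe_of_le_coe (hiG m)
  rw [dist_zero_right, Real.norm_eq_abs, hν', ← integral_sub (f.integrable _) hint]
  calc |∫ x, (f x - f (p (k i) x)) ∂(ν i : Measure X)|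
      ≤ η * (ν i : Measure X).real Set.univ
          + 2 * ‖f‖ * (ν i : Measure X).real (G m (k i))ᶜ := by
        refine abs_integral_le_of_forall_mem_le (hGm _ _) hη.le
          (fun x ↦ f.dist_le_two_norm _ _) fun x hx ↦ ?_
        have hxT : x ∈ T (k i) := by
          simp only [G, Set.mem_iInter, Finset.mem_Icc] at hx
          exact hx _ ⟨him, le_rfl⟩
        have := hfδ ((hpT _ x hxT).trans hiδ) (hpK _ _ x hx)
        rw [← Real.dist_eq, dist_comm]
        exact (show dist _ _ < η from this).le
    _ ≤ η * C + 2 * ‖f‖ * u m := by gcongr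
    _ < r := by linarith

/-- If finite measures converge weakly, then they are eventually almost concentrated on a set
covered by finitely many balls of a given radius. -/
theorem exists_eventually_measure_compl_lt_of_tendsto {X ι : Type*} [MetricSpace X]
    [CompleteSpace X] [TopologicalSpace.SeparableSpace X] [MeasurableSpace X] [BorelSpace X]
    {l : Filter ι} {ν : ι → FiniteMeasure X} {μ : FiniteMeasure X} (h : Tendsto ν l (𝓝 μ))
    {ε : ℝ} (hε : 0 < ε) :
    ∃ F : Finset X, ∀ᶠ i in l,
      (ν i : Measure X) (⋃ c ∈ F, ball c ε)ᶜ < ENNReal.ofReal ε := by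
  have : SecondCountableTopology X := UniformSpace.secondCountable_of_separable X
  obtain ⟨K, hK, hμK⟩ := isTightMeasureSet_iff_exists_isCompact_measure_compl_le.1
    (isTightMeasureSet_singleton (μ := (μ : Measure X))) (ENNReal.ofReal (ε / 2))
    (ENNReal.ofReal_pos.2 (half_pos hε))
  obtain ⟨t, -, htfin, htK⟩ := hK.finite_cover_balls hε
  refine ⟨htfin.toFinset, eventually_lt_of_limsup_lt ?_⟩
  have hcl : IsClosed (⋃ c ∈ htfin.toFinset, ball c ε)ᶜ :=
    (isOpen_biUnion fun _ _ ↦ isOpen_ball).isClosed_compl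
  calc limsup (fun i ↦ (ν i : Measure X) (⋃ c ∈ htfin.toFinset, ball c ε)ᶜ) l
      ≤ (μ : Measure X) (⋃ c ∈ htfin.toFinset, ball c ε)ᶜ :=
        FiniteMeasure.limsup_measure_closed_le_of_tendsto h hcl
    _ ≤ (μ : Measure X) Kᶜ := measure_mono (Set.compl_subset_compl.2 (by simpa using htK))
    _ ≤ ENNReal.ofReal (ε / 2) := hμK _ rfl
    _ < ENNReal.ofReal ε := (ENNReal.ofReal_lt_ofReal_iff hε).2 (half_lt_self hε)

/-- **Prokhorov theorem for ultralimits.** Let `(X,d)` be a Polish metric space,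
`ω` a non-principal ultrafilter on `ℕ`, and `(μs i)` Borel measures on `X` whose total masses
have a finite ultralimit along `ω`. Then the following are equivalent:
(i) for every `ε > 0` there is a Borel set `T`, contained in a finite union of open balls of
radius `ε`, with `lim_{i→ω} μs i (X \ T) ≤ ε` (spelled out: for every `δ > 0` the set of
indices with `μs i (X \ T) ≤ ε + δ` belongs to `ω`);
(ii) the ultralimit `μ = lim_{i→ω} μs i` exists with respect to weak convergence in duality
with the bounded continuous functions. -/
theorem stmt14 {X : Type*} [MetricSpace X] [CompleteSpace X]
    [TopologicalSpace.SeparableSpace X] [MeasurableSpace X] [BorelSpace X]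
    (ω : Ultrafilter ℕ) (hnp : ∀ a : ℕ, ({a} : Set ℕ) ∉ ω)
    (μs : ℕ → Measure X) (lam : ℝ≥0∞) (hlam : lam ≠ ⊤)
    (hmass : Tendsto (fun i => μs i Set.univ) (ω : Filter ℕ) (nhds lam)) :
    (∀ ε : ℝ, 0 < ε → ∃ T : Set X, MeasurableSet T ∧
        (∃ F : Finset X, T ⊆ ⋃ c ∈ F, Metric.ball c ε) ∧
        ∀ δ : ℝ, 0 < δ → {i : ℕ | μs i Tᶜ ≤ ENNReal.ofReal (ε + δ)} ∈ ω)
    ↔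
    (∃ μ : Measure X, IsFiniteMeasure μ ∧
      ∀ f : X → ℝ, Continuous f → (∃ C : ℝ, ∀ x, |f x| ≤ C) →
        Tendsto (fun i => ∫ x, f x ∂(μs i)) (ω : Filter ℕ) (nhds (∫ x, f x ∂μ))) := by
  classical
  have hω : (ω : Filter ℕ) ≤ atTop := by
    rw [← Nat.cofinite_eq_atTop, le_cofinite_iff_compl_singleton_mem]
    exact fun a ↦ Ultrafilter.compl_mem_iff_notMem.2 (hnp a)
  have hlt : ∀ᶠ i in (ω : Filter ℕ), μs i Set.univ < lam + 1 :=
    hmass.eventually_lt_const (ENNReal.lt_add_right hlam one_ne_zero)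
  let ν (i : ℕ) : FiniteMeasure X :=
    if h : IsFiniteMeasure (μs i) then ⟨μs i, h⟩ else 0
  have hν : ∀ᶠ i in (ω : Filter ℕ), (ν i : Measure X) = μs i := by
    filter_upwards [hlt] with i hi
    have : IsFiniteMeasure (μs i) := ⟨hi.trans_le le_top⟩
    simp [ν, this]
  have hlim (μ : FiniteMeasure X) : Tendsto ν ω (𝓝 μ) ↔
      ∀ f : X → ℝ, Continuous f → (∃ C : ℝ, ∀ x, |f x| ≤ C) →
        Tendsto (fun i => ∫ x, f x ∂(μs i)) (ω : Filter ℕ)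
          (𝓝 (∫ x, f x ∂(μ : Measure X))) := by
    have hcongr (f : X → ℝ) : (fun i ↦ ∫ x, f x ∂(ν i : Measure X)) =ᶠ[(ω : Filter ℕ)]
        fun i ↦ ∫ x, f x ∂(μs i) := by
      filter_upwards [hν] with i hi
      rw [hi]
    rw [FiniteMeasure.tendsto_iff_forall_integral_tendsto]
    refine ⟨fun h f hf ⟨C, hC⟩ ↦ ?_, fun h f ↦ ?_⟩
    · exact (h (BoundedContinuousFunction.ofNormedAddCommGroup f hf C hC)).congr' (hcongr f)
    · exact (h f f.continuous ⟨‖f‖, f.norm_coe_le_norm⟩).congr' (hcongr f).symm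
  constructor
  · intro h
    rcases isEmpty_or_nonempty X with hX | hX
    · refine ⟨0, inferInstance, fun f _ _ ↦ ?_⟩
      simp [Measure.eq_zero_of_isEmpty]
    obtain ⟨μ, hμ⟩ := exists_tendsto_finiteMeasure_of_eventually_measure_compl_le (ν := ν) hω
      (C := (lam + 1).toNNReal) (by
        filter_upwards [hν, hlt] with i hi hilt
        rw [← ENNReal.coe_le_coe, FiniteMeasure.ennreal_mass, hi,
          ENNReal.coe_toNNReal (by finiteness)]
        exact hilt.le) (fun η hη ↦ by
        obtain ⟨T, hTm, ⟨F, hF⟩, hT⟩ := h (η / 2) (half_pos hη)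
        refine ⟨T, hTm, ⟨F, hF.trans ?_⟩, ?_⟩
        · exact Set.iUnion₂_mono fun c _ ↦ ball_subset_ball (half_le_self hη.le)
        · filter_upwards [hν, hT (η / 2) (half_pos hη)] with i hi hiT
          rw [hi]
          simpa using hiT)
    exact ⟨μ, inferInstance, (hlim μ).1 hμ⟩
  · rintro ⟨μ, hμfin, hμ⟩ ε hε
    obtain ⟨F, hF⟩ := exists_eventually_measure_compl_lt_of_tendsto
      ((hlim ⟨μ, hμfin⟩).2 hμ) hε
    refine ⟨⋃ c ∈ F, ball c ε, (isOpen_biUnion fun _ _ ↦ isOpen_ball).measurableSet,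
      ⟨F, subset_rfl⟩, fun δ hδ ↦ ?_⟩
    filter_upwards [hν, hF] with i hi hiF
    rw [← hi]
    exact hiF.le.trans (ENNReal.ofReal_le_ofReal (by linarith))
end

section
/- Let {N_n}_{n∈ℕ} be a partition of ℕ into infinite sets, and let ω be a non-principal ultrafilter on ℕ that contains every subset S ⊆ ℕ such that N_n ∖ S is finite for all but finitely many n. Then there exist a complete separable metric space (X,d), Borel probability measures μ_i (i ∈ ℕ) on X, and a Borel probability measure μ on X such that for every bounded continuous f : X → ℝ the numbers ∫ f dμ_i converge along ω to ∫ f dμ, and yet for every compact set K ⊆ X the numbers μ_i(K) converge along ω to 0. -/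
universe u

/-- A Polish metric space: a complete separable metric space (with its Borel σ-algebra). -/
structure PMSpace : Type (u + 1) where
  Z : Type u
  [met : MetricSpace Z]
  [cpl : CompleteSpace Z]
  [sep : TopologicalSpace.SeparableSpace Z]
  [mea : MeasurableSpace Z]
  [bor : BorelSpace Z]

attribute [instance] PMSpace.met PMSpace.cpl PMSpace.sep PMSpace.mea PMSpace.bor

open Metric MeasureTheory Filter Topology
open scoped ENNReal

/-- In the Baire space, the points `Pi.single (c i) i` converge to `0` along any filter that
contains the complement of every fibre of `c`. -/
lemma tendsto_single_zero_of_fibre_compl_mem {l : Filter ℕ} (c : ℕ → ℕ)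
    (h : ∀ j, {i | c i ≠ j} ∈ l) :
    Tendsto (fun i => (Pi.single (c i) i : ℕ → ℕ)) l (𝓝 0) := by
  refine tendsto_pi_nhds.2 fun j => tendsto_nhds_of_eventually_eq ?_
  filter_upwards [h j] with i hi
  exact Pi.single_eq_of_ne (M := fun _ => ℕ) (Ne.symm hi) i

/-- A compact subset of the Baire space contains only finitely many of the points
`Pi.single n i`, for each fixed `n`. -/
lemma IsCompact.finite_single_mem {K : Set (ℕ → ℕ)} (hK : IsCompact K) (n : ℕ) :
    {i : ℕ | (Pi.single n i : ℕ → ℕ) ∈ K}.Finite := by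
  have hfin : ((fun x : ℕ → ℕ => x n) '' K).Finite :=
    (hK.image (continuous_apply n)).finite_of_discrete
  exact hfin.subset fun i hi => ⟨_, hi, Pi.single_eq_same (M := fun _ => ℕ) n i⟩

/-- **sharpness of the Prokhorov theorem for ultralimits.** Let `{N n}` be a
partition of `ℕ` into infinite sets and `ω` a non-principal ultrafilter containing every
`S ⊆ ℕ` such that `N n \ S` is finite for all but finitely many `n`. Then there are a Polish
metric space, Borel probability measures `μs i` and a Borel probability measure `μ` such that
`μs i → μ` weakly along `ω` (in duality with bounded continuous functions), yet
`μs i K → 0` along `ω` for every compact set `K`. -/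
theorem stmt15 (N : ℕ → Set ℕ)
    (hdisj : ∀ m n : ℕ, m ≠ n → Disjoint (N m) (N n))
    (hcover : ⋃ n, N n = Set.univ)
    (hinf : ∀ n, (N n).Infinite)
    (ω : Ultrafilter ℕ) (hnp : ∀ a : ℕ, ({a} : Set ℕ) ∉ ω)
    (hω : ∀ S : Set ℕ, {n : ℕ | ¬ (N n \ S).Finite}.Finite → S ∈ ω) :
    ∃ (W : PMSpace.{0}) (μs : ℕ → Measure W.Z) (μ : Measure W.Z),
      (∀ i, IsProbabilityMeasure (μs i)) ∧ IsProbabilityMeasure μ ∧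
      (∀ f : W.Z → ℝ, Continuous f → (∃ C : ℝ, ∀ x, |f x| ≤ C) →
        Tendsto (fun i => ∫ x, f x ∂(μs i)) (ω : Filter ℕ) (nhds (∫ x, f x ∂μ))) ∧
      (∀ K : Set W.Z, IsCompact K →
        Tendsto (fun i => μs i K) (ω : Filter ℕ) (nhds 0)) := by
  have hex : ∀ i, ∃ n, i ∈ N n := fun i => Set.mem_iUnion.1 (hcover ▸ Set.mem_univ i)
  choose c hc using hex
  have hc_eq : ∀ {i n}, i ∈ N n → c i = n := fun {i n} hi => by
    by_contra hne
    exact Set.disjoint_left.1 (hdisj _ _ hne) (hc i) hi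
  let x : ℕ → ℕ → ℕ := fun i => Pi.single (c i) i
  have hx : Tendsto x ω (𝓝 0) := by
    refine tendsto_single_zero_of_fibre_compl_mem c fun j => hω _ ?_
    refine (Set.finite_singleton j).subset fun n hn => ?_
    by_contra hnj
    refine hn (Set.finite_empty.subset fun i hi => hi.2 ?_)
    exact (hc_eq hi.1).trans_ne hnj
  let _ := TopologicalSpace.upgradeIsCompletelyMetrizable (ℕ → ℕ)
  refine ⟨⟨ℕ → ℕ⟩, fun i => Measure.dirac (x i), Measure.dirac 0,
    fun i => Measure.dirac.isProbabilityMeasure, Measure.dirac.isProbabilityMeasure, ?_, ?_⟩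
  · intro f hf _
    simp only [integral_dirac]
    exact (hf.tendsto 0).comp hx
  · intro K hK
    have hmem : {i | x i ∉ K} ∈ ω := by
      refine hω _ (Set.finite_empty.subset fun n hn => hn ?_)
      refine (hK.finite_single_mem n).subset fun i hi => ?_
      have hiK : x i ∈ K := not_not.1 hi.2
      simpa only [x, Set.mem_ofPred_eq, hc_eq hi.1] using hiK
    refine tendsto_nhds_of_eventually_eq ?_
    filter_upwards [hmem] with i hi
    rw [Measure.dirac_apply' _ hK.measurableSet]
    exact Set.indicator_of_notMem hi _
end

section
/- Let (X,d) be a complete separable metric space and m a boundedly finite nonnegative Borel measure on X which is pointwise doubling, i.e. limsup_{r↘0} m(B(x,2r))/m(B(x,r)) < +∞ for m-a.e. x ∈ X. Then for m-a.e. p ∈ X there exist a sequence r_i ↘ 0 and a pointed Polish metric measure space (Y,d_Y,m_Y,q) with m_Y boundedly finite and q ∈ spt(m_Y) such that the rescaled spaces (X, d/r_i, m / m(B_d(p,r_i)), p) converge to (Y,d_Y,m_Y,q) in the wpmGH sense; i.e., the wpmGH-tangent cone Tan(X,d,m,p) is non-empty for m-a.e. p ∈ X. -/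
universe u

/-- A pointed Polish metric measure space: a complete separable metric space equipped with a
Borel measure and a basepoint. -/
structure PMMS : Type (u + 1) where
  X : Type u
  [met : MetricSpace X]
  [cpl : CompleteSpace X]
  [sep : TopologicalSpace.SeparableSpace X]
  [mea : MeasurableSpace X]
  [bor : BorelSpace X]
  m : MeasureTheory.Measure X
  p : X

attribute [instance] PMMS.met PMMS.cpl PMMS.sep PMMS.mea PMMS.bor

open Metric MeasureTheory Filter Topology
open scoped ENNReal

/-- The measure of a pointed Polish metric measure space is boundedly finite: all balls have
finite measure. -/
def PMMS.BddFinite (A : PMMS.{u}) : Prop :=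
  ∀ (x : A.X) (r : ℝ), A.m (Metric.ball x r) < ⊤

/-- A weak `(R,ε)`-approximation from the rescaled pointed metric measure space
`(X, d/t, m / m(B(p,t)), p)` to a pointed Polish metric measure space `B`.
Note that a ball of radius `s` around `x` for the distance `d/t` is exactly `B_d(x, s*t)`,
the topology (hence the Borel σ-algebra) is unchanged, and the rescaled measure of a set `S`
is `m S / m (B(p,t))`. -/
def IsScaledWeakApprox {X : Type u} [MetricSpace X] [MeasurableSpace X] [BorelSpace X]
    (m : Measure X) (p : X) (t : ℝ) (B : PMMS.{u}) (R ε : ℝ) (ψ : X → B.X) : Prop :=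
  Measurable ψ ∧ ψ p = B.p ∧
  ∃ T : Set X, MeasurableSet T ∧ T ⊆ Metric.ball p (R * t) ∧ p ∈ T ∧
    (∀ x ∈ T, ∀ y ∈ T,
      dist x y / t - ε ≤ dist (ψ x) (ψ y) ∧ dist (ψ x) (ψ y) ≤ dist x y / t + ε) ∧
    m (Metric.ball p (R * t) \ T) / m (Metric.ball p t) ≤ ENNReal.ofReal ε ∧
    B.m (Metric.ball B.p (R - ε) \ Metric.thickening ε (ψ '' T)) ≤ ENNReal.ofReal ε

open scoped NNReal

/-- A sequence of countably many eventually bounded real sequences has a common subsequence along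
which all of them converge. -/
theorem exists_subseq_tendsto_of_eventually_abs_le {ι : Type*} [Countable ι] (a : ℕ → ι → ℝ)
    (M : ι → ℝ) (h : ∀ k, ∀ᶠ n in atTop, |a n k| ≤ M k) :
    ∃ φ : ℕ → ℕ, StrictMono φ ∧
      ∃ l : ι → ℝ, ∀ k, Tendsto (fun n => a (φ n) k) atTop (𝓝 (l k)) := by
  have hK : IsCompact (Set.pi Set.univ fun k => Set.Icc (-|M k|) |M k|) :=
    isCompact_univ_pi fun k => isCompact_Icc
  obtain ⟨l, -, φ, hφ, hl⟩ := hK.tendsto_subseq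
    (x := fun n k => max (-|M k|) (min |M k| (a n k))) (fun n k _ => by
      refine ⟨le_max_left _ _, max_le ?_ (min_le_left _ _)⟩
      linarith [abs_nonneg (M k)])
  refine ⟨φ, hφ, l, fun k => ?_⟩
  refine ((tendsto_pi_nhds.1 hl) k).congr' ?_
  filter_upwards [hφ.tendsto_atTop.eventually (h k)] with n hn
  have h1 := abs_le.1 (hn.trans (le_abs_self _))
  simp only [Function.comp]
  rw [min_eq_right h1.2, max_eq_right h1.1]

/-- A set all of whose `δ`-separated finite subsets have at most `N` elements has a `δ`-net with
at most `N + 1` elements starting at a prescribed point. -/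
theorem exists_net_of_separated_card_le {X : Type*} [MetricSpace X] {A : Set X} {δ : ℝ} {N : ℕ}
    (hN : ∀ s : Finset X, (s : Set X) ⊆ A →
      (s : Set X).Pairwise (fun x y => δ ≤ dist x y) → s.card ≤ N)
    {p : X} (hp : p ∈ A) (hδ : 0 < δ) :
    ∃ f : ℕ → X, f 0 = p ∧ (∀ k, f k ∈ A) ∧ ∀ x ∈ A, ∃ k ≤ N, dist x (f k) < δ := by
  classical
  let P : ℕ → Prop := fun c => ∃ s : Finset X, (s : Set X) ⊆ A ∧
    (s : Set X).Pairwise (fun x y => δ ≤ dist x y) ∧ s.card = c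
  have h0 : P 0 := ⟨∅, by simp, by simp, rfl⟩
  obtain ⟨s, hsA, hs, hc⟩ : P (Nat.findGreatest P N) := Nat.findGreatest_spec (Nat.zero_le N) h0
  have hcov : ∀ x ∈ A, ∃ y ∈ s, dist x y < δ := by
    intro x hx
    by_contra! hcon
    have hxs : x ∉ s := fun h => by simpa using (hcon x h).trans_lt' hδ
    have hins : P (s.card + 1) := by
      refine ⟨insert x s, ?_, ?_, Finset.card_insert_of_notMem hxs⟩
      · simpa [Set.insert_subset_iff] using ⟨hx, hsA⟩
      · rw [Finset.coe_insert]
        refine hs.insert fun y hy _ => ⟨hcon y hy, ?_⟩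
        rw [dist_comm]; exact hcon y hy
    obtain ⟨t, htA, ht, htc⟩ := hins
    have h1 := hN t htA ht
    have h2 := Nat.le_findGreatest (P := P) (htc ▸ h1) ⟨t, htA, ht, htc⟩
    omega
  have hsN := hN s hsA hs
  refine ⟨fun k => Nat.casesOn k p fun k => (s.toList[k]?).getD p, rfl, ?_, ?_⟩
  · rintro (_ | k)
    · exact hp
    · by_cases hk : k < s.toList.length
      · have : s.toList[k] ∈ s := Finset.mem_toList.1 (List.getElem_mem hk)
        simpa [List.getElem?_eq_getElem hk] using hsA this
      · simpa [List.getElem?_eq_none (not_lt.1 hk)] using hp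
  · intro x hx
    obtain ⟨y, hy, hxy⟩ := hcov x hx
    obtain ⟨k, hk, rfl⟩ := List.getElem_of_mem (Finset.mem_toList.2 hy)
    refine ⟨k + 1, ?_, ?_⟩
    · rw [Finset.length_toList] at hk; omega
    · simpa [List.getElem?_eq_getElem hk] using hxy

theorem integrable_and_abs_integral_le_of_measure_ball_le {Y : Type*} [MetricSpace Y]
    [MeasurableSpace Y] [BorelSpace Y] [SecondCountableTopology Y] {μ : Measure Y} {q : Y}
    {R B c : ℝ} {f : Y → ℝ} (hf : Continuous f) (hB : ∀ y, |f y| ≤ B)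
    (hR : ∀ y, y ∉ ball q R → f y = 0) (hμ : μ (ball q R) ≤ ENNReal.ofReal c) :
    Integrable f μ ∧ |∫ y, f y ∂μ| ≤ B * |c| := by
  have hsupp : Function.support f ⊆ ball q R := fun y hy => by
    by_contra h; exact hy (hR y h)
  have hfin : μ (ball q R) < ⊤ := hμ.trans_lt ENNReal.ofReal_lt_top
  have hB0 : 0 ≤ B := (abs_nonneg _).trans (hB q)
  have hon : IntegrableOn f (ball q R) μ :=
    Measure.integrableOn_of_bounded hfin.ne hf.aestronglyMeasurable
      (ae_of_all _ fun y => by simpa using hB y)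
  refine ⟨(integrableOn_iff_integrable_of_support_subset hsupp).1 hon, ?_⟩
  rw [← setIntegral_eq_integral_of_forall_compl_eq_zero (s := ball q R) hR]
  have := norm_setIntegral_le_of_norm_le_const (f := f) hfin (C := B)
    (fun y _ => by simpa using hB y)
  rw [Real.norm_eq_abs] at this
  refine this.trans (mul_le_mul_of_nonneg_left ?_ hB0)
  refine (ENNReal.toReal_mono ENNReal.ofReal_ne_top hμ).trans ?_
  rw [ENNReal.toReal_ofReal']
  exact max_le (le_abs_self _) (abs_nonneg _)

open CompactlySupported in
/-- Vague sequential compactness: in a proper metric space, a sequence of measures that is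
eventually bounded on every ball has a subsequence converging in duality with compactly supported
continuous functions to a measure that is finite on compact sets. -/
theorem exists_subseq_vague_tendsto {Y : Type*} [MetricSpace Y] [ProperSpace Y] [MeasurableSpace Y]
    [BorelSpace Y] (μ : ℕ → Measure Y) (q : Y) (C : ℝ → ℝ)
    (hC : ∀ R, ∀ᶠ n in atTop, μ n (ball q R) ≤ ENNReal.ofReal (C R)) :
    ∃ φ : ℕ → ℕ, StrictMono φ ∧ ∃ ν : Measure Y, IsFiniteMeasureOnCompacts ν ∧
      ∀ f : Y → ℝ, Continuous f → HasCompactSupport f →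
        Tendsto (fun n => ∫ y, f y ∂(μ (φ n))) atTop (𝓝 (∫ y, f y ∂ν)) := by
  have hintegral := fun (f : Y → ℝ) (R B : ℝ) (hf : Continuous f) (hB : ∀ y, |f y| ≤ B)
      (hR : ∀ y, y ∉ ball q R → f y = 0) n (hn : μ n (ball q R) ≤ ENNReal.ofReal (C R)) =>
    integrable_and_abs_integral_le_of_measure_ball_le hf hB hR hn
  let h : ℕ → Y → ℝ := fun N y => max 0 (min 1 (N + 1 - dist y q))
  have hcont : ∀ N, Continuous (h N) := fun N => by fun_prop
  have h0 : ∀ N y, 0 ≤ h N y := fun N y => le_max_left _ _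
  have h1 : ∀ N y, h N y ≤ 1 := fun N y => max_le zero_le_one (min_le_left _ _)
  have hone : ∀ (N : ℕ) y, dist y q ≤ N → h N y = 1 := fun N y hy => by
    have : (1 : ℝ) ≤ N + 1 - dist y q := by linarith
    simp [h, min_eq_left this]
  have hzero : ∀ (N : ℕ) y, y ∉ ball q (N + 1 : ℝ) → h N y = 0 := fun N y hy => by
    have : (N : ℝ) + 1 - dist y q ≤ 0 := by simpa using hy
    exact max_eq_left ((min_le_right _ _).trans this)
  have hbdd : ∀ (g : C(Y, ℝ)) (N : ℕ), ∃ B, ∀ y, |g y * h N y| ≤ B := by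
    intro g N
    obtain ⟨B, hB⟩ := (isCompact_closedBall q (N + 1 : ℝ)).exists_bound_of_continuousOn
      g.continuous.continuousOn
    refine ⟨max B 0, fun y => ?_⟩
    by_cases hy : y ∈ ball q (N + 1 : ℝ)
    · rw [abs_mul, abs_of_nonneg (h0 N y)]
      exact (mul_le_of_le_one_right (abs_nonneg _) (h1 N y)).trans
        ((hB y (ball_subset_closedBall hy)).trans (le_max_left _ _))
    · simp [hzero N y hy]
  choose B hB using hbdd
  let g := TopologicalSpace.denseSeq C(Y, ℝ)
  obtain ⟨φ, hφ, l, hl⟩ := exists_subseq_tendsto_of_eventually_abs_le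
    (fun n (k : ℕ × ℕ) => ∫ y, g k.1 y * h k.2 y ∂(μ n))
    (fun k => B (g k.1) k.2 * |C (k.2 + 1)|) (fun k => by
      filter_upwards [hC (k.2 + 1)] with n hn
      exact (hintegral _ _ _ ((g k.1).continuous.mul (hcont _)) (hB _ _)
        (fun y hy => by simp [hzero _ y hy]) n hn).2)
  have hCφ : ∀ R, ∀ᶠ n in atTop, μ (φ n) (ball q R) ≤ ENNReal.ofReal (C R) :=
    fun R => hφ.tendsto_atTop.eventually (hC R)
  have hsupp : ∀ f : C_c(Y, ℝ), ∃ N : ℕ, ∀ y, f y * h N y = f y := by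
    intro f
    obtain ⟨r, hr⟩ := (f.hasCompactSupport.isCompact.isBounded).subset_closedBall q
    obtain ⟨N, hN⟩ := exists_nat_ge r
    refine ⟨N, fun y => ?_⟩
    by_cases hy : y ∈ tsupport f
    · rw [hone N y ((mem_closedBall.1 (hr hy)).trans hN), mul_one]
    · simp [image_eq_zero_of_notMem_tsupport hy]
  have hInt : ∀ f : C_c(Y, ℝ), ∀ᶠ n in atTop, Integrable f (μ (φ n)) := by
    intro f
    obtain ⟨N, hN⟩ := hsupp f
    filter_upwards [hCφ (N + 1)] with n hn
    have := (hintegral (fun y => f y * h N y) _ _ (f.continuous.mul (hcont N)) (hB f.toContinuousMap N)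
        (fun y hy => by simp [hzero _ y hy]) _ hn).1
    simpa only [hN] using this
  have hconv : ∀ f : C_c(Y, ℝ), ∃ L, Tendsto (fun n => ∫ y, f y ∂(μ (φ n))) atTop (𝓝 L) := by
    intro f
    obtain ⟨N, hN⟩ := hsupp f
    refine cauchySeq_tendsto_of_complete (Metric.cauchySeq_iff'.2 fun ε hε => ?_)
    set D := |C (N + 1)| + 1 with hD
    have hDpos : 0 < D := by positivity
    set δ := ε / (4 * D) with hδ
    have hδpos : 0 < δ := by positivity
    obtain ⟨k, hk⟩ : ∃ k, ∀ y ∈ closedBall q (N + 1 : ℝ), dist (f y) (g k y) < δ := by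
      have hmem : {u : C(Y, ℝ) | ∀ y ∈ closedBall q (N + 1 : ℝ), dist (f y) (u y) < δ} ∈
          𝓝 f.toContinuousMap := by
        have := (ContinuousMap.tendsto_iff_forall_isCompact_tendstoUniformlyOn
          (f := f.toContinuousMap) (F := id) (p := 𝓝 f.toContinuousMap)).1 tendsto_id _
          (isCompact_closedBall q (N + 1 : ℝ))
        exact Metric.tendstoUniformlyOn_iff.1 this δ hδpos
      obtain ⟨u, hu, k, rfl⟩ := mem_closure_iff_nhds.1
        (TopologicalSpace.denseRange_denseSeq C(Y, ℝ) f.toContinuousMap) _ hmem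
      exact ⟨k, hu⟩
    have happrox : ∀ᶠ n in atTop,
        |∫ y, f y ∂(μ (φ n)) - ∫ y, g k y * h N y ∂(μ (φ n))| ≤ ε / 4 := by
      filter_upwards [hCφ (N + 1), hInt f] with n hn hfn
      have hg := (hintegral (fun y => g k y * h N y) _ _ ((g k).continuous.mul (hcont N)) (hB (g k) N)
        (fun y hy => by simp [hzero _ y hy]) _ hn).1
      rw [← integral_sub hfn hg]
      refine (hintegral (fun y => f y - g k y * h N y) (N + 1) δ (f.continuous.sub
        ((g k).continuous.mul (hcont N))) (fun y => ?_) (fun y hy => ?_) _ hn).2.trans ?_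
      · rw [← hN y, ← sub_mul, abs_mul, abs_of_nonneg (h0 N y)]
        by_cases hy : y ∈ ball q (N + 1 : ℝ)
        · exact (mul_le_of_le_one_right (abs_nonneg _) (h1 N y)).trans
            (hk y (ball_subset_closedBall hy)).le
        · simp [hzero N y hy, hδpos.le]
      · rw [← hN y]; simp [hzero N y hy]
      · calc δ * |C (N + 1)| ≤ δ * D := by gcongr; linarith
          _ = ε / 4 := by rw [hδ]; field_simp
    have hcau := Metric.cauchySeq_iff'.1 (hl (k, N)).cauchySeq (ε / 4) (by positivity)
    obtain ⟨n₁, hn₁⟩ := hcau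
    obtain ⟨n₂, hn₂⟩ := eventually_atTop.1 happrox
    refine ⟨max n₁ n₂, fun n hn => ?_⟩
    have a1 := hn₂ n ((le_max_right _ _).trans hn)
    have a2 := hn₂ _ (le_max_right n₁ n₂)
    have a3 := hn₁ n ((le_max_left _ _).trans hn)
    have a4 := hn₁ _ (le_max_left n₁ n₂)
    rw [Real.dist_eq] at a3 a4 ⊢
    rw [abs_lt] at a3 a4 ⊢
    rw [abs_le] at a1 a2
    simp only at a3 a4
    constructor <;> linarith [a1.1, a1.2, a2.1, a2.2, a3.1, a3.2, a4.1, a4.2]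
  choose Λ hΛ using hconv
  let L : C_c(Y, ℝ) →ₚ[ℝ] ℝ := PositiveLinearMap.mk₀
    { toFun := Λ
      map_add' := fun f f' => by
        refine tendsto_nhds_unique (hΛ (f + f')) (((hΛ f).add (hΛ f')).congr' ?_)
        filter_upwards [hInt f, hInt f'] with n h1 h2
        exact (integral_add h1 h2).symm
      map_smul' := fun c f => by
        refine tendsto_nhds_unique (hΛ (c • f)) (((hΛ f).const_mul c).congr fun n => ?_)
        exact (integral_const_mul c _).symm }
    (fun f hf => ge_of_tendsto' (hΛ f) fun n => integral_nonneg hf)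
  refine ⟨φ, hφ, RealRMK.rieszMeasure L, inferInstance, fun f hf hfc => ?_⟩
  have := RealRMK.integral_rieszMeasure L ⟨⟨f, hf⟩, hfc⟩
  have h3 := hΛ ⟨⟨f, hf⟩, hfc⟩
  change ∫ y, f y ∂_ = Λ ⟨⟨f, hf⟩, hfc⟩ at this
  rw [this]
  exact h3

theorem measure_ball_two_pow_mul_le {X : Type*} [MetricSpace X] [MeasurableSpace X]
    {m : Measure X} {x : X} {C : ℝ≥0} {n : ℕ}
    (hx : ∀ k ≥ n, m (ball x (2 * (1 / 2) ^ k)) ≤ C * m (ball x ((1 / 2) ^ k))) (l : ℕ) :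
    ∀ k ≥ n + l, m (ball x (2 ^ l * (1 / 2) ^ k)) ≤ C ^ l * m (ball x ((1 / 2) ^ k)) := by
  induction l with
  | zero => intro k _; simp
  | succ l ih =>
    intro k hk
    obtain ⟨k, rfl⟩ : ∃ k', k = k' + 1 := ⟨k - 1, by omega⟩
    have e1 : (2 : ℝ) ^ (l + 1) * (1 / 2) ^ (k + 1) = 2 ^ l * (1 / 2) ^ k := by
      rw [pow_succ, pow_succ]; ring
    have e2 : ((1 : ℝ) / 2) ^ k = 2 * (1 / 2) ^ (k + 1) := by rw [pow_succ]; ring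
    rw [e1]
    refine (ih k (by omega)).trans ?_
    rw [pow_succ, mul_assoc]
    gcongr
    rw [e2]
    exact hx (k + 1) (by omega)

theorem measurable_measure_ball {X : Type*} [MetricSpace X] [TopologicalSpace.SeparableSpace X]
    [MeasurableSpace X] [BorelSpace X] (m : Measure X) [SFinite m] (r : ℝ) :
    Measurable fun x => m (ball x r) := by
  have := UniformSpace.secondCountable_of_separable X
  have hs : MeasurableSet {z : X × X | dist z.2 z.1 < r} :=
    measurableSet_lt (measurable_snd.dist measurable_fst) measurable_const
  exact measurable_measure_prodMk_left hs

/-- A form of the Lebesgue density theorem along dyadic radii for a set on which a measure is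
uniformly doubling at small dyadic scales. -/
theorem ae_eventually_measure_ball_diff_le {X : Type*} [MetricSpace X]
    [TopologicalSpace.SeparableSpace X] [MeasurableSpace X] [BorelSpace X]
    (m : Measure X) (hbf : ∀ (x : X) (r : ℝ), m (ball x r) < ⊤)
    {E : Set X} (hE : MeasurableSet E) {C : ℝ≥0} {n : ℕ}
    (hd : ∀ x ∈ E, ∀ k ≥ n, m (ball x (2 * (1 / 2) ^ k)) ≤ C * m (ball x ((1 / 2) ^ k))) :
    ∀ᵐ x ∂m, x ∈ E → ∀ δ : ℝ≥0, 0 < δ →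
      ∀ᶠ k : ℕ in atTop, m (ball x ((1 / 2) ^ k) \ E) ≤ δ * m (ball x ((1 / 2) ^ k)) := by
  have := UniformSpace.secondCountable_of_separable X
  have : IsLocallyFiniteMeasure m := ⟨fun x => ⟨ball x 1, ball_mem_nhds x one_pos, hbf x 1⟩⟩
  rcases isEmpty_or_nonempty X with hX | ⟨⟨o⟩⟩
  · exact ae_of_all _ fun x => (hX.false x).elim
  have key : ∀ (δ : ℝ≥0) (N : ℕ), 0 < δ → m {x | x ∈ E ∩ ball o N ∧
      ∃ᶠ k : ℕ in atTop, δ * m (ball x ((1 / 2) ^ k)) < m (ball x ((1 / 2) ^ k) \ E)} = 0 := by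
    intro δ N hδ
    set A := {x | x ∈ E ∩ ball o N ∧
      ∃ᶠ k : ℕ in atTop, δ * m (ball x ((1 / 2) ^ k)) < m (ball x ((1 / 2) ^ k) \ E)} with hA
    suffices h : (δ : ℝ≥0∞) * m A = 0 by
      rcases mul_eq_zero.1 h with h | h
      · exact absurd (by exact_mod_cast h) hδ.ne'
      · exact h
    refine le_antisymm (ENNReal.le_of_forall_pos_le_add fun θ hθ _ => ?_) bot_le
    rw [zero_add]
    obtain ⟨U, hEU, hU, -, hUη⟩ := (hE.inter measurableSet_ball).exists_isOpen_sdiff_lt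
      (μ := m) (A := E ∩ ball o N)
      ((measure_mono Set.inter_subset_right).trans_lt (hbf o N)).ne
      (ε := (θ : ℝ≥0∞) / (C + 1)) (by
        simp only [ne_eq, ENNReal.div_eq_zero_iff, ENNReal.coe_eq_zero, not_or]
        exact ⟨hθ.ne', by finiteness⟩)
    let t : Set (X × ℕ) := {a | a.1 ∈ A ∧ n + 2 ≤ a.2 ∧ closedBall a.1 ((1 / 2) ^ a.2) ⊆ U ∧
      δ * m (ball a.1 ((1 / 2) ^ a.2)) < m (ball a.1 ((1 / 2) ^ a.2) \ E)}
    let B : X × ℕ → Set X := fun a => closedBall a.1 ((1 / 2) ^ a.2)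
    obtain ⟨u, hut, huc, hud, hu0⟩ := Vitali.exists_disjoint_covering_ae m A t (C ^ 2)
      (fun a => (1 / 2) ^ a.2) (fun a => a.1) B (fun a _ => subset_rfl)
      (fun a ha => by
        have h2 := measure_ball_two_pow_mul_le (hd a.1 ha.1.1.1) 2 a.2 ha.2.1
        have hpos : (0 : ℝ) < (1 / 2) ^ a.2 := by positivity
        calc m (closedBall a.1 (3 * (1 / 2) ^ a.2))
            ≤ m (ball a.1 (2 ^ 2 * (1 / 2) ^ a.2)) :=
              measure_mono (closedBall_subset_ball (by nlinarith))
          _ ≤ _ := h2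
          _ ≤ _ := by push_cast; gcongr; exact ball_subset_closedBall)
      (fun a _ => ⟨a.1, ball_subset_interior_closedBall (mem_ball_self (by positivity))⟩)
      (fun a _ => isClosed_closedBall)
      (fun x hx ε hε => by
        have hxU : x ∈ U := hEU hx.1
        obtain ⟨s, hs, hsU⟩ := Metric.isOpen_iff.1 hU x hxU
        have hlim : Tendsto (fun k : ℕ => ((1 : ℝ) / 2) ^ k) atTop (𝓝 0) :=
          tendsto_pow_atTop_nhds_zero_of_lt_one (by norm_num) (by norm_num)
        have hev : ∀ᶠ k : ℕ in atTop, ((1 : ℝ) / 2) ^ k < min s ε :=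
          hlim.eventually_lt_const (lt_min hs hε)
        obtain ⟨k, hk, hk1, hk2⟩ := (hx.2.and_eventually (hev.and (eventually_ge_atTop (n + 2)))).exists
        exact ⟨(x, k), ⟨hx, hk2,
          (closedBall_subset_ball (hk1.trans_le (min_le_left _ _))).trans hsU, hk⟩,
          (hk1.trans_le (min_le_right _ _)).le, rfl⟩)
    have hball : ∀ a ∈ u, δ * m (B a) ≤ C * m (B a \ E) := fun a ha => by
      obtain ⟨h1, h2, -, h4⟩ := hut ha
      have h5 := hd a.1 h1.1.1 a.2 (by omega)
      have hpos : (0 : ℝ) < (1 / 2) ^ a.2 := by positivity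
      calc δ * m (B a) ≤ δ * m (ball a.1 (2 * (1 / 2) ^ a.2)) := by
            gcongr; exact closedBall_subset_ball (by linarith)
        _ ≤ δ * (C * m (ball a.1 ((1 / 2) ^ a.2))) := by gcongr
        _ = C * (δ * m (ball a.1 ((1 / 2) ^ a.2))) := by ring
        _ ≤ C * m (ball a.1 ((1 / 2) ^ a.2) \ E) := by gcongr
        _ ≤ C * m (B a \ E) := by gcongr; exact ball_subset_closedBall
    have hBm : ∀ a ∈ u, MeasurableSet (B a) := fun a _ => measurableSet_closedBall
    calc δ * m A ≤ δ * m (⋃ a ∈ u, B a) := by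
          refine mul_le_mul' le_rfl ?_
          refine (measure_le_inter_add_sdiff m A (⋃ a ∈ u, B a)).trans ?_
          rw [hu0, add_zero]
          exact measure_mono Set.inter_subset_right
      _ = ∑' a : u, δ * m (B a) := by
          rw [measure_biUnion huc hud hBm, ENNReal.tsum_mul_left]
      _ ≤ ∑' a : u, C * m (B a \ E) := ENNReal.tsum_le_tsum fun a => hball a a.2
      _ = C * m (⋃ a ∈ u, B a \ E) := by
          rw [ENNReal.tsum_mul_left, measure_biUnion huc
            (hud.mono fun a => Set.sdiff_subset) fun a ha => (hBm a ha).diff hE]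
      _ ≤ C * m (U \ (E ∩ ball o N)) := by
          gcongr
          refine Set.iUnion₂_subset fun a ha y hy => ⟨(hut ha).2.2.1 hy.1, fun h => hy.2 h.1⟩
      _ ≤ (C + 1) * (θ / (C + 1)) := by gcongr; exact le_self_add
      _ ≤ θ := ENNReal.mul_div_le
  have hall : ∀ᵐ x ∂m, ∀ j N : ℕ, ¬ (x ∈ E ∩ ball o N ∧ ∃ᶠ k : ℕ in atTop,
      ((1 / (j + 1) : ℝ≥0) : ℝ≥0∞) * m (ball x ((1 / 2) ^ k)) < m (ball x ((1 / 2) ^ k) \ E)) := by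
    rw [ae_all_iff]; intro j
    rw [ae_all_iff]; intro N
    rw [ae_iff]
    simpa only [not_not] using key (1 / (j + 1)) N (by positivity)
  filter_upwards [hall] with x hx hxE δ hδ
  obtain ⟨j, hj⟩ := exists_nat_one_div_lt hδ
  obtain ⟨N, hN⟩ := exists_nat_gt (dist x o)
  have h1 := hx j N
  simp only [not_and, not_frequently, not_lt] at h1
  filter_upwards [h1 ⟨hxE, hN⟩] with k hk
  refine hk.trans ?_
  gcongr

theorem ae_exists_dyadic_doubling_density {X : Type*} [MetricSpace X]
    [TopologicalSpace.SeparableSpace X] [MeasurableSpace X] [BorelSpace X]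
    (m : Measure X) (hbf : ∀ (x : X) (r : ℝ), m (ball x r) < ⊤)
    (hdoub : ∀ᵐ x ∂m, Filter.limsup
        (fun r : ℝ => m (Metric.ball x (2 * r)) / m (Metric.ball x r))
        (nhdsWithin 0 (Set.Ioi 0)) < ⊤) :
    ∀ᵐ p ∂m, (∀ r > 0, 0 < m (ball p r)) ∧ ∃ (E : Set X) (C : ℝ≥0) (n : ℕ), MeasurableSet E ∧
      p ∈ E ∧
      (∀ x ∈ E, ∀ k ≥ n, m (ball x (2 * (1 / 2) ^ k)) ≤ C * m (ball x ((1 / 2) ^ k))) ∧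
      ∀ δ : ℝ≥0, 0 < δ →
        ∀ᶠ k : ℕ in atTop, m (ball p ((1 / 2) ^ k) \ E) ≤ δ * m (ball p ((1 / 2) ^ k)) := by
  have := UniformSpace.secondCountable_of_separable X
  have : IsLocallyFiniteMeasure m := ⟨fun x => ⟨ball x 1, ball_mem_nhds x one_pos, hbf x 1⟩⟩
  let E : ℕ → Set X := fun n =>
    {x | ∀ k ≥ n, m (ball x (2 * (1 / 2) ^ k)) ≤ (n : ℝ≥0) * m (ball x ((1 / 2) ^ k))}
  have hE : ∀ n, MeasurableSet (E n) := fun n => by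
    have : E n = ⋂ k ≥ n,
        {x | m (ball x (2 * (1 / 2) ^ k)) ≤ (n : ℝ≥0) * m (ball x ((1 / 2) ^ k))} := by
      ext x; simp [E]
    rw [this]
    exact MeasurableSet.iInter fun k => MeasurableSet.iInter fun _ =>
      measurableSet_le (measurable_measure_ball m _) ((measurable_measure_ball m _).const_mul _)
  have hdens := ae_all_iff.2 fun n => ae_eventually_measure_ball_diff_le m hbf (hE n)
    (C := n) (n := n) (fun x hx => hx)
  have hsupp : ∀ᵐ p ∂m, p ∈ m.support := Measure.support_mem_ae
  filter_upwards [hdoub, hdens, hsupp] with p hp hpd hps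
  refine ⟨fun r hr => ?_, ?_⟩
  · rw [Measure.mem_support_iff_forall] at hps
    exact hps _ (ball_mem_nhds p hr)
  · obtain ⟨c, hc1, hc2⟩ := exists_between hp
    lift c to ℝ≥0 using hc2.ne
    have hev := eventually_lt_of_limsup_lt hc1
    have hlim : Tendsto (fun k : ℕ => ((1 : ℝ) / 2) ^ k) atTop (𝓝[>] 0) :=
      tendsto_nhdsWithin_iff.2 ⟨tendsto_pow_atTop_nhds_zero_of_lt_one (by norm_num) (by norm_num),
        Eventually.of_forall fun k => by simp⟩
    obtain ⟨n₁, hn₁⟩ := eventually_atTop.1 (hlim.eventually hev)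
    obtain ⟨n₂, hn₂⟩ := exists_nat_ge c
    set n := max n₁ n₂
    have hpE : p ∈ E n := fun k hk => by
      have h1 := (hn₁ k ((le_max_left _ _).trans hk)).le
      have h2 : m (ball p (2 * (1 / 2) ^ k)) ≤ c * m (ball p ((1 / 2) ^ k)) := by
        rcases eq_or_ne (m (ball p ((1 / 2) ^ k))) 0 with h0 | h0
        · rw [h0, mul_zero]
          by_contra hne
          rw [h0, ENNReal.div_zero (by simpa using hne)] at h1
          simp at h1
        · exact (ENNReal.div_le_iff h0 (hbf _ _).ne).1 h1
      refine h2.trans ?_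
      gcongr
      exact hn₂.trans (by exact_mod_cast le_max_right n₁ n₂)
    exact ⟨E n, n, n, hE n, hpE, fun x hx => hx, hpd n hpE⟩

theorem exists_card_bound_eventually_net {X : Type*} [MetricSpace X] [MeasurableSpace X]
    [BorelSpace X] {m : Measure X} (hbf : ∀ (x : X) (r : ℝ), m (ball x r) < ⊤)
    {p : X} (hpos : ∀ r > 0, 0 < m (ball p r)) {E : Set X} {C : ℝ≥0} {n : ℕ} (hp : p ∈ E)
    (hd : ∀ x ∈ E, ∀ k ≥ n, m (ball x (2 * (1 / 2) ^ k)) ≤ C * m (ball x ((1 / 2) ^ k)))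
    (j : ℕ) :
    ∃ N : ℕ, ∀ᶠ i : ℕ in atTop, ∃ f : ℕ → X, f 0 = p ∧
      (∀ k, f k ∈ E ∩ ball p (2 ^ j * (1 / 2) ^ i)) ∧
      ∀ x ∈ E ∩ ball p (2 ^ j * (1 / 2) ^ i), ∃ k ≤ N, dist x (f k) < (1 / 2) ^ j * (1 / 2) ^ i := by
  refine ⟨⌈C ^ (2 * j + 3)⌉₊, ?_⟩
  filter_upwards [eventually_ge_atTop (n + j + 2)] with i hi
  have hr : (0 : ℝ) < (1 / 2) ^ i := by positivity
  have hj : (1 : ℝ) ≤ 2 ^ j := one_le_pow₀ (by norm_num)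
  refine exists_net_of_separated_card_le (fun s hs hsep => ?_)
    ⟨hp, mem_ball_self (by positivity)⟩ (by positivity)
  have hsmall : ((1 : ℝ) / 2) ^ (i + j + 1) = (1 / 2) ^ j * (1 / 2) ^ i / 2 := by
    rw [pow_succ, pow_add]; ring
  have hlarge : (2 : ℝ) ^ (2 * j + 3) * (1 / 2) ^ (i + j + 1) = 4 * (2 ^ j * (1 / 2) ^ i) := by
    have : (2 : ℝ) ^ j * (1 / 2) ^ j = 1 := by rw [← mul_pow]; norm_num
    rw [hsmall, pow_add, two_mul, pow_add]
    linear_combination 4 * (2 ^ j * (1 / 2) ^ i) * this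
  set M := m (ball p (2 * (2 ^ j * (1 / 2) ^ i))) with hM
  have hM0 : M ≠ 0 := (hpos _ (by positivity)).ne'
  have hMtop : M ≠ ⊤ := (hbf _ _).ne
  have hle : ∀ x ∈ s, M ≤ C ^ (2 * j + 3) * m (ball x ((1 / 2) ^ (i + j + 1))) := fun x hx => by
    refine le_trans (measure_mono ?_)
      (measure_ball_two_pow_mul_le (hd x (hs hx).1) (2 * j + 3) (i + j + 1) (by omega))
    rw [hlarge]
    have h1 := mem_ball.1 (hs hx).2
    refine ball_subset_ball' ?_
    rw [dist_comm p x]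
    linarith [mul_pos (zero_lt_one.trans_le hj) hr]
  have hsum : (s.card : ℝ≥0∞) * M ≤ C ^ (2 * j + 3) * M := by
    calc (s.card : ℝ≥0∞) * M = ∑ x ∈ s, M := by simp
      _ ≤ ∑ x ∈ s, C ^ (2 * j + 3) * m (ball x ((1 / 2) ^ (i + j + 1))) := Finset.sum_le_sum hle
      _ = C ^ (2 * j + 3) * m (⋃ x ∈ s, ball x ((1 / 2) ^ (i + j + 1))) := by
          rw [measure_biUnion_finset _ fun x _ => measurableSet_ball, Finset.mul_sum]
          intro x hx y hy hxy
          refine ball_disjoint_ball ?_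
          have := hsep hx hy hxy
          rw [hsmall]; linarith
      _ ≤ C ^ (2 * j + 3) * M := by
          refine mul_le_mul' le_rfl (measure_mono ?_)
          refine Set.iUnion₂_subset fun x hx => ?_
          refine ball_subset_ball' ?_
          have h1 := mem_ball.1 (hs hx).2
          rw [hsmall]
          have : ((1 : ℝ) / 2) ^ j * (1 / 2) ^ i ≤ 2 ^ j * (1 / 2) ^ i := by
            gcongr; norm_num
          linarith [mul_pos (zero_lt_one.trans_le hj) hr]
  have hcard : (s.card : ℝ≥0∞) ≤ C ^ (2 * j + 3) := (ENNReal.mul_le_mul_iff_left hM0 hMtop).1 hsum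
  have : (s.card : ℝ≥0) ≤ C ^ (2 * j + 3) := by exact_mod_cast hcard
  exact_mod_cast this.trans (Nat.le_ceil _)

theorem properSpace_completion_of_finite_nets {L : Type*} [PseudoMetricSpace L] (a₀ : L)
    (h : ∀ R ε : ℝ, 0 < ε → ∃ s : Set L, s.Finite ∧
      ∀ a, dist a a₀ < R → ∃ b ∈ s, dist a b ≤ ε) :
    ProperSpace (UniformSpace.Completion L) := by
  refine ProperSpace.of_isCompact_closedBall_of_le (0 : ℝ) fun x R _ => ?_
  refine isCompact_iff_totallyBounded_isComplete.2
    ⟨Metric.totallyBounded_iff.2 fun ε hε => ?_, isClosed_closedBall.isComplete⟩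
  obtain ⟨s, hs, hcov⟩ := h (R + dist x (a₀ : UniformSpace.Completion L) + 1) (ε / 4) (by positivity)
  refine ⟨(fun a : L => (a : UniformSpace.Completion L)) '' s, hs.image _, fun z hz => ?_⟩
  obtain ⟨a, ha⟩ := (Metric.denseRange_iff.1 UniformSpace.Completion.denseRange_coe) z
    (min 1 (ε / 4)) (by positivity)
  have ha1 := ha.trans_le (min_le_left _ _)
  have ha2 := ha.trans_le (min_le_right _ _)
  obtain ⟨b, hb, hab⟩ := hcov a (by
    rw [← UniformSpace.Completion.dist_eq]
    have h1 := dist_triangle4 (a : UniformSpace.Completion L) z x a₀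
    rw [dist_comm (a : UniformSpace.Completion L) z] at h1
    linarith [mem_closedBall.1 hz])
  rw [Set.biUnion_image]
  refine Set.mem_iUnion₂.2 ⟨b, hb, ?_⟩
  rw [← UniformSpace.Completion.dist_eq] at hab
  exact mem_ball.2 ((dist_triangle _ _ _).trans_lt (by linarith))

/-- Labels for the points of a countable family of nets. -/
structure NetLabel : Type u where
  level : ℕ
  index : ℕ

/-- Gromov compactness for pointed nets: if rescaled sets have, at every level, nets whose
cardinality is bounded independently of the scale, then along a subsequence the distances between
net points converge to the distances between points of a proper space that they approximate. -/
theorem exists_proper_limit_of_nets {X : Type*} [MetricSpace X] (p : X) (E : Set X) (r : ℕ → ℝ)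
    (hr : ∀ i, 0 < r i) (hp : p ∈ E) (N : ℕ → ℕ)
    (hnet : ∀ j, ∀ᶠ i : ℕ in atTop, ∃ f : ℕ → X, f 0 = p ∧
      (∀ k, f k ∈ E ∩ ball p (2 ^ j * r i)) ∧
      ∀ x ∈ E ∩ ball p (2 ^ j * r i), ∃ k ≤ N j, dist x (f k) < (1 / 2) ^ j * r i) :
    ∃ φ : ℕ → ℕ, StrictMono φ ∧ ∃ (Y : Type u) (_ : MetricSpace Y) (_ : ProperSpace Y)
      (y : ℕ → ℕ → Y) (q : Y) (x : ℕ → ℕ → ℕ → X),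
      (∀ j, y j 0 = q) ∧ (∀ i j, x i j 0 = p) ∧
      (∀ i j k, x i j k ∈ E ∩ ball p (2 ^ j * r (φ i))) ∧
      (∀ j k k', Tendsto (fun i => dist (x i j k) (x i j k') / r (φ i)) atTop
        (𝓝 (dist (y j k) (y j k')))) ∧
      (∀ j, ∀ᶠ i : ℕ in atTop, ∀ z ∈ E ∩ ball p (2 ^ j * r (φ i)),
        ∃ k ≤ N j, dist z (x i j k) < (1 / 2) ^ j * r (φ i)) ∧
      ∀ j, ∀ z : Y, dist z q < 2 ^ j → ∃ k ≤ N j, dist z (y j k) ≤ 2 * (1 / 2) ^ j := by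
  have hex : ∀ i j, ∃ f : ℕ → X, f 0 = p ∧ (∀ k, f k ∈ E ∩ ball p (2 ^ j * r i)) ∧
      ((∃ f : ℕ → X, f 0 = p ∧ (∀ k, f k ∈ E ∩ ball p (2 ^ j * r i)) ∧
        ∀ x ∈ E ∩ ball p (2 ^ j * r i), ∃ k ≤ N j, dist x (f k) < (1 / 2) ^ j * r i) →
      ∀ x ∈ E ∩ ball p (2 ^ j * r i), ∃ k ≤ N j, dist x (f k) < (1 / 2) ^ j * r i) := by
    intro i j
    by_cases h : ∃ f : ℕ → X, f 0 = p ∧ (∀ k, f k ∈ E ∩ ball p (2 ^ j * r i)) ∧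
        ∀ x ∈ E ∩ ball p (2 ^ j * r i), ∃ k ≤ N j, dist x (f k) < (1 / 2) ^ j * r i
    · obtain ⟨f, h1, h2, h3⟩ := h
      exact ⟨f, h1, h2, fun _ => h3⟩
    · exact ⟨fun _ => p, rfl, fun _ => ⟨hp, mem_ball_self (mul_pos (by positivity) (hr i))⟩,
        fun h' => absurd h' h⟩
  choose x hx0 hxE hxcov using hex
  have hcov : ∀ j, ∀ᶠ i : ℕ in atTop, ∀ z ∈ E ∩ ball p (2 ^ j * r i),
      ∃ k ≤ N j, dist z (x i j k) < (1 / 2) ^ j * r i := fun j =>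
    (hnet j).mono fun i hi => hxcov i j hi
  obtain ⟨φ, hφ, D, hD⟩ := exists_subseq_tendsto_of_eventually_abs_le
    (fun i (a : (ℕ × ℕ) × (ℕ × ℕ)) => dist (x i a.1.1 a.1.2) (x i a.2.1 a.2.2) / r i)
    (fun a => 2 ^ a.1.1 + 2 ^ a.2.1) (fun a => Eventually.of_forall fun i => by
      have h1 := mem_ball.1 (hxE i a.1.1 a.1.2).2
      have h2 := mem_ball.1 (hxE i a.2.1 a.2.2).2
      rw [abs_of_nonneg (div_nonneg dist_nonneg (hr i).le), div_le_iff₀ (hr i)]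
      have := dist_triangle_right (x i a.1.1 a.1.2) (x i a.2.1 a.2.2) p
      linarith)
  let inst : PseudoMetricSpace NetLabel.{u} :=
    { dist := fun a b => D ((a.level, a.index), (b.level, b.index))
      dist_self := fun a => tendsto_nhds_unique (hD _) (by simp)
      dist_comm := fun a b => tendsto_nhds_unique (hD _) (by
        simpa only [dist_comm] using hD ((b.level, b.index), (a.level, a.index)))
      dist_triangle := fun a b c => le_of_tendsto_of_tendsto' (hD _) ((hD _).add (hD _))
        fun i => by
          rw [← add_div]
          exact div_le_div_of_nonneg_right (dist_triangle _ _ _) (hr _).le }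
  have hlim : ∀ a b : NetLabel.{u}, Tendsto (fun i => dist (x (φ i) a.level a.index)
      (x (φ i) b.level b.index) / r (φ i)) atTop (𝓝 (dist a b)) := fun a b => hD _
  let a₀ : NetLabel.{u} := ⟨0, 0⟩
  have hnear : ∀ (j : ℕ) (a : NetLabel.{u}), dist a a₀ < 2 ^ j →
      ∃ k ≤ N j, dist a ⟨j, k⟩ ≤ (1 / 2) ^ j := by
    intro j a ha
    by_contra! hcon
    have hfar : ∀ᶠ i in atTop, ∀ k ∈ Set.Iic (N j), (1 / 2 : ℝ) ^ j <
        dist (x (φ i) a.level a.index) (x (φ i) j k) / r (φ i) :=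
      (Set.finite_Iic (N j)).eventually_all.2 fun k hk =>
        (hlim a ⟨j, k⟩).eventually_const_lt (hcon k hk)
    obtain ⟨i, hi1, hi2, hi3⟩ := (hfar.and ((hφ.tendsto_atTop.eventually (hcov j)).and
      ((hlim a a₀).eventually_lt_const ha))).exists
    have hmem : x (φ i) a.level a.index ∈ E ∩ ball p (2 ^ j * r (φ i)) := by
      refine ⟨(hxE _ _ _).1, ?_⟩
      simp only [a₀, hx0] at hi3
      exact mem_ball.2 ((div_lt_iff₀ (hr _)).1 hi3)
    obtain ⟨k, hk, hk'⟩ := hi2 _ hmem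
    have := hi1 k hk
    rw [lt_div_iff₀ (hr _)] at this
    linarith
  have hproper : ProperSpace (UniformSpace.Completion NetLabel.{u}) := by
    refine properSpace_completion_of_finite_nets a₀ fun R ε hε => ?_
    obtain ⟨j₁, hj₁⟩ := pow_unbounded_of_one_lt R (one_lt_two : (1 : ℝ) < 2)
    obtain ⟨j₂, hj₂⟩ := exists_pow_lt_of_lt_one hε (by norm_num : (1 / 2 : ℝ) < 1)
    refine ⟨(fun k => ⟨max j₁ j₂, k⟩) '' Set.Iic (N (max j₁ j₂)), (Set.finite_Iic _).image _,
      fun a ha => ?_⟩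
    obtain ⟨k, hk, hk'⟩ := hnear (max j₁ j₂) a (ha.trans (hj₁.trans_le
      (pow_le_pow_right₀ (by norm_num) (le_max_left _ _))))
    refine ⟨_, ⟨k, hk, rfl⟩, hk'.trans (le_trans ?_ hj₂.le)⟩
    exact pow_le_pow_of_le_one (by norm_num) (by norm_num) (le_max_right _ _)
  refine ⟨φ, hφ, UniformSpace.Completion NetLabel.{u}, inferInstance, hproper,
    fun j k => ((⟨j, k⟩ : NetLabel.{u}) : UniformSpace.Completion NetLabel.{u}),
    (a₀ : UniformSpace.Completion NetLabel.{u}), fun i => x (φ i), fun j => ?_,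
    fun i j => hx0 _ _, fun i j k => hxE _ _ _, fun j k k' => ?_,
    fun j => hφ.tendsto_atTop.eventually (hcov j), fun j z hz => ?_⟩
  · rw [← dist_eq_zero, UniformSpace.Completion.dist_eq]
    refine tendsto_nhds_unique (hlim _ _) ?_
    simp [a₀, hx0]
  · rw [UniformSpace.Completion.dist_eq]
    exact hlim ⟨j, k⟩ ⟨j, k'⟩
  · obtain ⟨a, ha⟩ := (Metric.denseRange_iff.1 UniformSpace.Completion.denseRange_coe) z
      (min ((1 / 2) ^ j) (2 ^ j - dist z (a₀ : UniformSpace.Completion NetLabel.{u})))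
      (lt_min (by positivity) (by linarith))
    have ha1 := ha.trans_le (min_le_left _ _)
    have ha2 := ha.trans_le (min_le_right _ _)
    obtain ⟨k, hk, hk'⟩ := hnear j a (by
      rw [← UniformSpace.Completion.dist_eq]
      have := dist_triangle_left (a : UniformSpace.Completion NetLabel.{u}) a₀ z
      linarith)
    refine ⟨k, hk, ?_⟩
    rw [← UniformSpace.Completion.dist_eq] at hk'
    refine (dist_triangle _ (a : UniformSpace.Completion NetLabel.{u}) _).trans ?_
    linarith

theorem exists_measurable_nearest_map {X Y : Type*} [MetricSpace X] [MeasurableSpace X]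
    [BorelSpace X] [MeasurableSpace Y] {p : X} {T : Set X} (hT : MeasurableSet T) (hp : p ∈ T)
    {δ : ℝ} (hδ : 0 < δ) {N : ℕ} {f : ℕ → X} (hf0 : f 0 = p)
    (hcov : ∀ x ∈ T, ∃ k ≤ N, dist x (f k) < δ) (y : ℕ → Y) (w : Y) :
    ∃ ψ : X → Y, Measurable ψ ∧ ψ p = y 0 ∧
      (∀ x ∈ T, ∃ k ≤ N, ψ x = y k ∧ dist x (f k) < δ) ∧ ∀ x ∉ T, ψ x = w := by
  classical
  let P : X → ℕ → Prop := fun x k => dist x (f k) < δ ∨ N < k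
  have hP : ∀ x, ∃ k, P x k := fun x => ⟨N + 1, Or.inr (Nat.lt_succ_self N)⟩
  have hmeas : Measurable fun x => Nat.find (hP x) := measurable_find hP fun k =>
    (measurableSet_ball (x := f k) (ε := δ)).union (MeasurableSet.const (N < k))
  refine ⟨T.piecewise (fun x => y (Nat.find (hP x))) fun _ => w,
    Measurable.piecewise hT ((Measurable.of_discrete (f := y)).comp hmeas) measurable_const,
    ?_, fun x hx => ?_, fun x hx => Set.piecewise_eq_of_notMem _ _ _ hx⟩
  · rw [Set.piecewise_eq_of_mem _ _ _ hp]
    have : Nat.find (hP p) = 0 := (Nat.find_eq_zero _).2 (Or.inl (by simpa [hf0] using hδ))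
    rw [this]
  · obtain ⟨k, hk, hxk⟩ := hcov x hx
    have hle : Nat.find (hP x) ≤ N := (Nat.find_min' (hP x) (Or.inl hxk)).trans hk
    refine ⟨Nat.find (hP x), hle, Set.piecewise_eq_of_mem _ _ _ hx, ?_⟩
    exact (Nat.find_spec (hP x)).resolve_right (not_lt.2 hle)

theorem eventually_measure_ball_two_pow_mul_diff_le {X : Type*} [MetricSpace X]
    [MeasurableSpace X] {m : Measure X} {p : X} {E : Set X} {C : ℝ≥0} {n : ℕ}
    (hd : ∀ k ≥ n, m (ball p (2 * (1 / 2) ^ k)) ≤ C * m (ball p ((1 / 2) ^ k)))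
    (hdens : ∀ δ : ℝ≥0, 0 < δ →
      ∀ᶠ k : ℕ in atTop, m (ball p ((1 / 2) ^ k) \ E) ≤ δ * m (ball p ((1 / 2) ^ k)))
    (j : ℕ) {δ : ℝ≥0} (hδ : 0 < δ) :
    ∀ᶠ i : ℕ in atTop,
      m (ball p (2 ^ j * (1 / 2) ^ i) \ E) ≤ δ * m (ball p ((1 / 2) ^ i)) := by
  have h1 := (tendsto_sub_atTop_nat j).eventually (hdens (δ / (C + 1) ^ j) (by positivity))
  filter_upwards [h1, eventually_ge_atTop (n + j)] with i hi hin
  have hrad : (2 : ℝ) ^ j * (1 / 2) ^ i = (1 / 2) ^ (i - j) := by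
    obtain ⟨k, rfl⟩ : ∃ k, i = k + j := ⟨i - j, by omega⟩
    have : (2 : ℝ) ^ j * (1 / 2) ^ j = 1 := by rw [← mul_pow]; norm_num
    rw [Nat.add_sub_cancel, pow_add]
    linear_combination (1 / 2 : ℝ) ^ k * this
  have h2 := measure_ball_two_pow_mul_le hd j i hin
  rw [hrad] at h2 ⊢
  calc m (ball p ((1 / 2) ^ (i - j)) \ E)
      ≤ (δ / (C + 1) ^ j : ℝ≥0) * m (ball p ((1 / 2) ^ (i - j))) := hi
    _ ≤ (δ / (C + 1) ^ j : ℝ≥0) * (C ^ j * m (ball p ((1 / 2) ^ i))) := by gcongr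
    _ = ((δ / (C + 1) ^ j * C ^ j : ℝ≥0) : ℝ≥0∞) * m (ball p ((1 / 2) ^ i)) := by
        push_cast; ring
    _ ≤ δ * m (ball p ((1 / 2) ^ i)) := by
        gcongr
        calc δ / (C + 1) ^ j * C ^ j ≤ δ / (C + 1) ^ j * (C + 1) ^ j := by gcongr; simp
          _ = δ := div_mul_cancel₀ _ (by positivity)

/-- Support of a vague limit: if the open set where `g` does not vanish is eventually null in every
ball, then it is null for the limit measure. -/
theorem measure_eq_zero_of_vague_tendsto {Y : Type*} [MetricSpace Y] [ProperSpace Y]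
    [MeasurableSpace Y] [BorelSpace Y] {μ : ℕ → Measure Y} {ν : Measure Y}
    [IsFiniteMeasureOnCompacts ν]
    (hμ : ∀ f : Y → ℝ, Continuous f → HasCompactSupport f →
      Tendsto (fun n => ∫ y, f y ∂(μ n)) atTop (𝓝 (∫ y, f y ∂ν))) (q : Y) {g : Y → ℝ}
    (hg : Continuous g) (hg0 : ∀ y, 0 ≤ g y)
    (h : ∀ R, ∀ᶠ n in atTop, μ n ({y | g y ≠ 0} ∩ ball q R) = 0) :
    ν {y | g y ≠ 0} = 0 := by
  have hball : ∀ N : ℕ, ν ({y | g y ≠ 0} ∩ ball q N) = 0 := by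
    intro N
    let f : Y → ℝ := fun y => g y * max 0 (N - dist y q)
    have hf : Continuous f := by fun_prop
    have hsupp : Function.support f = {y | g y ≠ 0} ∩ ball q N := by
      ext y
      have : max 0 ((N : ℝ) - dist y q) ≠ 0 ↔ dist y q < N := by
        rw [ne_eq, max_eq_left_iff, not_le, sub_pos]
      simp only [f, Function.mem_support, mul_ne_zero_iff, this]
      rfl
    have hfc : HasCompactSupport f := HasCompactSupport.intro (isCompact_closedBall q N)
      fun y hy => by
        by_contra hne
        have : y ∈ Function.support f := hne
        rw [hsupp] at this
        exact hy (ball_subset_closedBall this.2)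
    have hzero : ∫ y, f y ∂ν = 0 := by
      refine tendsto_nhds_unique (hμ f hf hfc) (tendsto_const_nhds.congr' ?_)
      filter_upwards [h N] with n hn
      refine (integral_eq_zero_of_ae ?_).symm
      rw [← hsupp] at hn
      exact hn
    have hae := (integral_eq_zero_iff_of_nonneg
      (fun y => mul_nonneg (hg0 y) (le_max_left _ _)) (hf.integrable_of_hasCompactSupport hfc)).1
      hzero
    rw [← hsupp]
    exact hae
  rw [← Set.inter_univ {y | g y ≠ 0}, ← iUnion_ball_nat q, Set.inter_iUnion]
  exact measure_iUnion_null hball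

/-- Positivity of a vague limit on balls with uniformly positive mass. -/
theorem measure_ball_pos_of_vague_tendsto {Y : Type*} [MetricSpace Y] [ProperSpace Y]
    [MeasurableSpace Y] [BorelSpace Y] {μ : ℕ → Measure Y} {ν : Measure Y}
    (hμ : ∀ f : Y → ℝ, Continuous f → HasCompactSupport f →
      Tendsto (fun n => ∫ y, f y ∂(μ n)) atTop (𝓝 (∫ y, f y ∂ν))) {q : Y} {s C c : ℝ}
    (hs : 0 < s) (hc : 0 < c)
    (hfin : ∀ᶠ n in atTop, μ n (ball q s) ≤ ENNReal.ofReal C)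
    (hlow : ∀ᶠ n in atTop, c ≤ (μ n).real (ball q (s / 2))) :
    0 < ν (ball q s) := by
  rw [pos_iff_ne_zero]
  intro h0
  let f : Y → ℝ := fun y => max 0 (s - dist y q)
  have hf : Continuous f := by fun_prop
  have hf0 : ∀ y, y ∉ ball q s → f y = 0 := fun y hy => max_eq_left (by
    rw [mem_ball, not_lt] at hy; linarith)
  have hfc : HasCompactSupport f := HasCompactSupport.intro (isCompact_closedBall q s)
    fun y hy => hf0 y fun h => hy (ball_subset_closedBall h)
  have hzero : ∫ y, f y ∂ν = 0 := by
    refine integral_eq_zero_of_ae (measure_mono_null (fun y hy => ?_) h0)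
    by_contra hne
    exact hy (hf0 y hne)
  have hfs : ∀ y, |f y| ≤ s := fun y => by
    rw [abs_of_nonneg (le_max_left _ _)]
    exact max_le hs.le (by linarith [dist_nonneg (x := y) (y := q)])
  have hge : s / 2 * c ≤ ∫ y, f y ∂ν := by
    refine ge_of_tendsto (hμ f hf hfc) ?_
    filter_upwards [hfin, hlow] with n hn hn'
    have hintegral := (integrable_and_abs_integral_le_of_measure_ball_le hf hfs hf0 hn).1
    refine le_trans ?_ (mul_meas_ge_le_integral_of_nonneg
      (ae_of_all _ fun y => le_max_left _ _) hintegral (s / 2))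
    gcongr
    refine hn'.trans (measureReal_mono (fun y hy => ?_) ?_)
    · rw [mem_ball] at hy
      have h1 : s / 2 ≤ s - dist y q := by linarith
      exact h1.trans (le_max_right _ _)
    · refine ne_top_of_le_ne_top (ne_top_of_le_ne_top ENNReal.ofReal_ne_top hn)
        (measure_mono fun y hy => ?_)
      by_contra hne
      have h1 : s / 2 ≤ f y := hy
      rw [hf0 y hne] at h1
      linarith
  rw [hzero] at hge
  nlinarith

/-- At a density point of a uniformly doubling set, along a sequence of dyadic scales the rescaled
spaces have almost isometric, almost surjective maps to a common proper space. The limit space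
carries an additional real factor, into which the bad part of `X` is sent far away. -/
theorem exists_measurable_almost_isometries {X : Type*} [MetricSpace X] [MeasurableSpace X]
    [BorelSpace X] {m : Measure X} (hbf : ∀ (x : X) (r : ℝ), m (ball x r) < ⊤)
    {p : X} (hpos : ∀ r > 0, 0 < m (ball p r)) {E : Set X} {C : ℝ≥0} {n : ℕ}
    (hE : MeasurableSet E) (hp : p ∈ E)
    (hd : ∀ x ∈ E, ∀ k ≥ n, m (ball x (2 * (1 / 2) ^ k)) ≤ C * m (ball x ((1 / 2) ^ k)))
    (hdens : ∀ δ : ℝ≥0, 0 < δ →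
      ∀ᶠ k : ℕ in atTop, m (ball p ((1 / 2) ^ k) \ E) ≤ δ * m (ball p ((1 / 2) ^ k))) :
    ∃ τ : ℕ → ℕ, StrictMono τ ∧ ∃ (Y : Type u) (_ : MetricSpace Y) (_ : ProperSpace Y)
      (_ : MeasurableSpace Y) (_ : BorelSpace Y) (q : Y) (ψ : ℕ → X → Y × ℝ),
      (∀ j, Measurable (ψ j)) ∧ (∀ j, ψ j p = (q, 0)) ∧
      (∀ j, ∀ x ∈ E ∩ ball p (2 ^ j * (1 / 2) ^ τ j), (ψ j x).2 = 0) ∧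
      (∀ j, ∀ x ∉ E ∩ ball p (2 ^ j * (1 / 2) ^ τ j), ψ j x = (q, (j : ℝ))) ∧
      (∀ j, ∀ x ∈ E ∩ ball p (2 ^ j * (1 / 2) ^ τ j),
        ∀ x' ∈ E ∩ ball p (2 ^ j * (1 / 2) ^ τ j),
        |dist (ψ j x) (ψ j x') - dist x x' / (1 / 2) ^ τ j| ≤ 3 * (1 / 2) ^ j) ∧
      (∀ j, ∀ z : Y, dist z q < 2 ^ j → ∃ x ∈ E ∩ ball p (2 ^ j * (1 / 2) ^ τ j),
        dist (z, (0 : ℝ)) (ψ j x) ≤ 4 * (1 / 2) ^ j) ∧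
      ∀ j, m (ball p (2 ^ j * (1 / 2) ^ τ j) \ E) ≤
        ((1 / 2 : ℝ≥0) ^ j : ℝ≥0) * m (ball p ((1 / 2) ^ τ j)) := by
  choose N hN using fun j => exists_card_bound_eventually_net hbf hpos hp hd j
  obtain ⟨φ, hφ, Y, _, _, y, q, x, hy0, hx0, hxT, hlim, hcov, hnet⟩ :=
    exists_proper_limit_of_nets p E (fun i => (1 / 2) ^ i) (fun i => by positivity) hp N hN
  have hdist : ∀ j, ∀ᶠ i in atTop, ∀ k ∈ Finset.range (N j + 1), ∀ k' ∈ Finset.range (N j + 1),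
      |dist (y j k) (y j k') - dist (x i j k) (x i j k') / (1 / 2) ^ φ i| < (1 / 2) ^ j := by
    intro j
    rw [Filter.eventually_all_finset]
    intro k _
    rw [Filter.eventually_all_finset]
    intro k' _
    filter_upwards [Metric.tendsto_nhds.1 (hlim j k k') ((1 / 2) ^ j) (by positivity)] with i hi
    rwa [dist_comm, Real.dist_eq] at hi
  obtain ⟨σ, hσ, h⟩ := extraction_forall_of_eventually fun j =>
    (hcov j).and ((hdist j).and (hφ.tendsto_atTop.eventually
      (eventually_measure_ball_two_pow_mul_diff_le (hd p hp) hdens j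
        (δ := (1 / 2) ^ j) (by positivity))))
  let : MeasurableSpace Y := borel Y
  have : BorelSpace Y := ⟨rfl⟩
  have hpT : ∀ j, p ∈ E ∩ ball p (2 ^ j * (1 / 2) ^ φ (σ j)) := fun j =>
    ⟨hp, mem_ball_self (by positivity)⟩
  choose ψ hψm hψp hψT hψc using fun j => exists_measurable_nearest_map
    (hE.inter (measurableSet_ball (x := p) (ε := 2 ^ j * (1 / 2) ^ φ (σ j)))) (hpT j)
    (δ := (1 / 2) ^ j * (1 / 2) ^ φ (σ j)) (by positivity) (hx0 (σ j) j) (h j).1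
    (fun k => (y j k, (0 : ℝ))) (q, (j : ℝ))
  refine ⟨φ ∘ σ, hφ.comp hσ, Y, inferInstance, inferInstance, inferInstance, inferInstance, q, ψ,
    hψm, fun j => by rw [hψp, hy0], fun j z hz => ?_, hψc, fun j z hz z' hz' => ?_,
    fun j z hz => ?_, fun j => (h j).2.2⟩
  · obtain ⟨k, -, hk, -⟩ := hψT j z hz
    rw [hk]
  · obtain ⟨k, hkN, hk, hzk⟩ := hψT j z hz
    obtain ⟨k', hkN', hk', hzk'⟩ := hψT j z' hz'
    have hkk := (h j).2.1 k (by simpa [Nat.lt_succ_iff] using hkN) k'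
      (by simpa [Nat.lt_succ_iff] using hkN')
    rw [hk, hk', dist_prod_same_right]
    simp only [Function.comp_apply]
    set t : ℝ := (1 / 2) ^ φ (σ j)
    have ht : 0 < t := by positivity
    have h1 : |dist (x (σ j) j k) (x (σ j) j k') / t - dist z z' / t| ≤ 2 * (1 / 2) ^ j := by
      rw [← sub_div, abs_div, abs_of_pos ht, div_le_iff₀ ht, ← Real.dist_eq]
      have := dist_dist_dist_le (x (σ j) j k) (x (σ j) j k') z z'
      rw [dist_comm (x (σ j) j k) z, dist_comm (x (σ j) j k') z'] at this
      linarith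
    have h2 := abs_sub_le (dist (y j k) (y j k')) (dist (x (σ j) j k) (x (σ j) j k') / t)
      (dist z z' / t)
    linarith
  · obtain ⟨k, hkN, hzk⟩ := hnet j z hz
    refine ⟨x (σ j) j k, hxT (σ j) j k, ?_⟩
    obtain ⟨k', hkN', hk', hxk'⟩ := hψT j _ (hxT (σ j) j k)
    have hkk := (h j).2.1 k (by simpa [Nat.lt_succ_iff] using hkN) k'
      (by simpa [Nat.lt_succ_iff] using hkN')
    rw [hk', dist_prod_same_right]
    have ht : (0 : ℝ) < (1 / 2) ^ φ (σ j) := by positivity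
    have h1 : dist (x (σ j) j k) (x (σ j) j k') / (1 / 2) ^ φ (σ j) ≤ (1 / 2) ^ j := by
      rw [div_le_iff₀ ht]; exact hxk'.le
    have h2 := (abs_lt.1 hkk).2
    linarith [dist_triangle z (y j k) (y j k')]

/-- Almost isometries at the scale `t` pull back balls around the base point into balls, up to
points sent to height `h` in the second factor. -/
theorem preimage_ball_subset_of_almost_isometry {X Y : Type*} [MetricSpace X] [MetricSpace Y]
    {p : X} {q : Y} {T : Set X} {ψ : X → Y × ℝ} {t δ h R : ℝ} (ht : 0 < t) (hp : p ∈ T)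
    (hψp : ψ p = (q, 0)) (hψc : ∀ x ∉ T, ψ x = (q, h)) (hRh : R ≤ h)
    (hψ : ∀ x ∈ T, ∀ x' ∈ T, |dist (ψ x) (ψ x') - dist x x' / t| ≤ δ) :
    ψ ⁻¹' ball (q, 0) R ⊆ T ∩ ball p ((R + δ) * t) := by
  intro x hx
  rw [Set.mem_preimage, mem_ball] at hx
  have hxT : x ∈ T := by
    by_contra hne
    rw [hψc x hne, dist_prod_same_left, Real.dist_eq, sub_zero] at hx
    linarith [le_abs_self h]
  refine ⟨hxT, ?_⟩
  have h1 := (abs_le.1 (hψ x hxT p hp)).1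
  rw [hψp] at h1
  rw [mem_ball, ← div_lt_iff₀ ht]
  linarith

/-- Almost isometries at the scale `t` send small balls into small balls. -/
theorem inter_ball_subset_preimage_of_almost_isometry {X Y : Type*} [MetricSpace X]
    [MetricSpace Y] {p : X} {q : Y} {T : Set X} {ψ : X → Y} {t δ s : ℝ} (ht : 0 < t)
    (hp : p ∈ T) (hψp : ψ p = q)
    (hψ : ∀ x ∈ T, ∀ x' ∈ T, |dist (ψ x) (ψ x') - dist x x' / t| ≤ δ) :
    T ∩ ball p (s * t) ⊆ ψ ⁻¹' ball q (s + δ) := by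
  rintro x ⟨hxT, hx⟩
  have h1 := (abs_le.1 (hψ x hxT p hp)).2
  rw [mem_ball, ← div_lt_iff₀ ht] at hx
  rw [hψp] at h1
  rw [Set.mem_preimage, mem_ball]
  linarith

/-- If the part of a ball outside `E` is a small fraction `δ` of its mass and a concentric ball
has mass comparable to it, then `E` charges the smaller ball. -/
theorem inv_le_toReal_inv_mul_measure_inter {X : Type*} [MeasurableSpace X] {m : Measure X}
    {A B E : Set X} {D δ : ℝ≥0} (hA0 : m A ≠ 0) (hA : m A ≠ ⊤) (hBA : B ⊆ A)
    (hD : m A ≤ D * m B) (hδ : m (A \ E) ≤ δ * m A) (hDδ : 2 * D * δ ≤ 1) (hD0 : 0 < D) :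
    (2 * (D : ℝ))⁻¹ ≤ ((m A)⁻¹ * m (E ∩ B)).toReal := by
  have hEB : m (E ∩ B) ≠ ⊤ :=
    ne_top_of_le_ne_top hA (measure_mono (Set.inter_subset_right.trans hBA))
  have h1 : m B ≤ m (E ∩ B) + m (A \ E) :=
    (measure_mono fun x hx => by
      by_cases hxE : x ∈ E
      · exact Or.inl ⟨hxE, hx⟩
      · exact Or.inr ⟨hBA hx, hxE⟩).trans (measure_union_le _ _)
  lift m A to ℝ≥0 using hA with a
  lift m (E ∩ B) to ℝ≥0 using hEB with b
  have h2 : (a : ℝ≥0∞) ≤ D * (b + δ * a) := hD.trans (by gcongr; exact h1.trans (by gcongr))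
  have h3 : a ≤ D * (b + δ * a) := by exact_mod_cast h2
  have ha : (0 : ℝ) < a := by
    have : a ≠ 0 := by exact_mod_cast hA0
    exact_mod_cast pos_iff_ne_zero.2 this
  have h4 : (a : ℝ) ≤ D * (b + δ * a) := by exact_mod_cast h3
  have h5 : 2 * (D : ℝ) * δ ≤ 1 := by exact_mod_cast hDδ
  have hD' : (0 : ℝ) < D := by exact_mod_cast hD0
  rw [ENNReal.toReal_mul, ENNReal.toReal_inv, ENNReal.coe_toReal, ENNReal.coe_toReal,
    inv_mul_eq_div, le_div_iff₀ ha, inv_mul_le_iff₀ (by positivity)]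
  nlinarith [mul_le_mul_of_nonneg_right h5 ha.le]

/-- **existence of wpmGH tangents to pointwise doubling spaces.** Let `(X,d)` be
a Polish metric space and `m` a boundedly finite, pointwise doubling Borel measure on `X`. Then
for `m`-a.e. `p ∈ X` there exist a sequence `rs i ↘ 0` and a pointed Polish metric measure
space `B = (Y, d_Y, m_Y, q)` with `m_Y` boundedly finite and `q ∈ spt m_Y` such that the
rescaled spaces `(X, d/rs i, m / m(B(p, rs i)), p)` converge to `B` in the weak pointed
measured Gromov–Hausdorff sense: there are `R i ↗ ∞`, `ε i ↘ 0` and weak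
`(R i, ε i)`-approximations `ψ i` from the rescaled spaces to `B` whose pushforwards of the
rescaled measures converge weakly to `m_Y` in duality with `C_bbs(Y)`. -/
theorem stmt19 {X : Type u} [MetricSpace X] [CompleteSpace X]
    [TopologicalSpace.SeparableSpace X] [MeasurableSpace X] [BorelSpace X]
    (m : Measure X) (hbf : ∀ (x : X) (r : ℝ), m (Metric.ball x r) < ⊤)
    (hdoub : ∀ᵐ x ∂m, Filter.limsup
        (fun r : ℝ => m (Metric.ball x (2 * r)) / m (Metric.ball x r))
        (nhdsWithin 0 (Set.Ioi 0)) < ⊤) :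
    ∀ᵐ p ∂m, ∃ rs : ℕ → ℝ,
      (∀ i, 0 < rs i) ∧ Antitone rs ∧ Tendsto rs atTop (nhds 0) ∧
      ∃ B : PMMS.{u}, B.BddFinite ∧ (∀ s : ℝ, 0 < s → 0 < B.m (Metric.ball B.p s)) ∧
        ∃ (R ε : ℕ → ℝ) (ψ : ∀ _ : ℕ, X → B.X),
          Monotone R ∧ Tendsto R atTop atTop ∧
          Antitone ε ∧ Tendsto ε atTop (nhds 0) ∧ (∀ i, 0 < ε i ∧ ε i < R i) ∧
          (∀ i, IsScaledWeakApprox m p (rs i) B (R i) (ε i) (ψ i)) ∧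
          (∀ f : B.X → ℝ, Continuous f → (∃ C : ℝ, ∀ y, |f y| ≤ C) →
            Bornology.IsBounded (Function.support f) →
            Tendsto
              (fun i => ∫ y, f y ∂(Measure.map (ψ i) ((m (Metric.ball p (rs i)))⁻¹ • m)))
              atTop (nhds (∫ y, f y ∂B.m))) := by
  filter_upwards [ae_exists_dyadic_doubling_density m hbf hdoub] with p hgood
  obtain ⟨hpos, E, C, n, hE, hp, hd, hdens⟩ := hgood
  obtain ⟨τ, hτ, Y, _, _, _, _, q, ψ, hψm, hψp, hψT, hψc, hψd, hψs, hψE⟩ :=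
    exists_measurable_almost_isometries.{u} hbf hpos hE hp hd hdens
  have hhalf : Tendsto (fun j : ℕ => (1 / 2 : ℝ) ^ j) atTop (𝓝 0) :=
    tendsto_pow_atTop_nhds_zero_of_lt_one (by norm_num) (by norm_num)
  have htwo : Tendsto (fun j : ℕ => (2 : ℝ) ^ j) atTop atTop :=
    tendsto_pow_atTop_atTop_of_one_lt (by norm_num)
  have hhalf_anti : Antitone fun j : ℕ => (1 / 2 : ℝ) ^ j :=
    pow_right_anti₀ (by norm_num) (by norm_num)
  set t : ℕ → ℝ := fun j => (1 / 2) ^ τ j with ht_def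
  have ht : ∀ j, 0 < t j := fun j => by positivity
  have hj1 : ∀ j : ℕ, (1 : ℝ) ≤ 2 ^ j := fun j => one_le_pow₀ (by norm_num)
  have hj2 : ∀ j : ℕ, (1 / 2 : ℝ) ^ j ≤ 1 := fun j => pow_le_one₀ (by norm_num) (by norm_num)
  set T : ℕ → Set X := fun j => E ∩ ball p (2 ^ j * t j) with hT_def
  have hpT : ∀ j, p ∈ T j := fun j => ⟨hp, mem_ball_self (mul_pos (by positivity) (ht j))⟩
  have hM0 : ∀ j, m (ball p (t j)) ≠ 0 := fun j => (hpos _ (ht j)).ne'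
  have hMt : ∀ j, m (ball p (t j)) ≠ ⊤ := fun j => (hbf _ _).ne
  have hpre : ∀ R : ℝ, ∀ j : ℕ, R ≤ j →
      ψ j ⁻¹' ball (q, 0) R ⊆ T j ∩ ball p ((R + 3 * (1 / 2) ^ j) * t j) := fun R j hR =>
    preimage_ball_subset_of_almost_isometry (ht j) (hpT j) (hψp j) (hψc j) hR (hψd j)
  set μ : ℕ → Measure (Y × ℝ) := fun j => Measure.map (ψ j) ((m (ball p (t j)))⁻¹ • m) with hμ_def
  have hμ_apply : ∀ j, ∀ S, MeasurableSet S →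
      μ j S = (m (ball p (t j)))⁻¹ * m (ψ j ⁻¹' S) := fun j S hS => by
    rw [hμ_def, Measure.map_apply (hψm j) hS, Measure.smul_apply, smul_eq_mul]
  have hup : ∀ R : ℝ, ∃ c : ℝ, ∀ᶠ j in atTop, μ j (ball (q, 0) R) ≤ ENNReal.ofReal c := by
    intro R
    obtain ⟨l, hl⟩ := (htwo.eventually_ge_atTop (R + 3)).exists
    refine ⟨(C ^ l : ℝ≥0), ?_⟩
    filter_upwards [hτ.tendsto_atTop.eventually_ge_atTop (n + l),
      tendsto_natCast_atTop_atTop.eventually_ge_atTop R] with j hj hjR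
    rw [hμ_apply j _ measurableSet_ball, ENNReal.ofReal_coe_nnreal, ENNReal.coe_pow]
    calc (m (ball p (t j)))⁻¹ * m (ψ j ⁻¹' ball (q, 0) R)
        ≤ (m (ball p (t j)))⁻¹ * (C ^ l * m (ball p (t j))) := by
          gcongr
          refine (measure_mono ((hpre R j hjR).trans (Set.inter_subset_right.trans
            (ball_subset_ball ?_)))).trans (measure_ball_two_pow_mul_le (hd p hp) l (τ j) hj)
          exact mul_le_mul_of_nonneg_right (by linarith [hj2 j]) (ht j).le
      _ = C ^ l := by
          rw [mul_comm, mul_assoc, ENNReal.mul_inv_cancel (hM0 j) (hMt j), mul_one]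
  choose c hc using hup
  obtain ⟨ρ, hρ, ν, _, hν⟩ := exists_subseq_vague_tendsto μ (q, 0) c hc
  have hν0 : ν {y | |y.2| ≠ 0} = 0 := by
    refine measure_eq_zero_of_vague_tendsto hν (q, 0) (by fun_prop) (fun y => abs_nonneg y.2)
      fun R => ?_
    filter_upwards [hρ.tendsto_atTop.eventually
      (tendsto_natCast_atTop_atTop.eventually_ge_atTop R)] with i hi
    have hmeas : MeasurableSet ({y : Y × ℝ | |y.2| ≠ 0} ∩ ball (q, 0) R) := by
      refine MeasurableSet.inter (IsOpen.measurableSet ?_) measurableSet_ball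
      exact isOpen_ne_fun (by fun_prop) continuous_const
    rw [hμ_apply _ _ hmeas]
    have : ψ (ρ i) ⁻¹' ({y : Y × ℝ | |y.2| ≠ 0} ∩ ball (q, 0) R) = ∅ := by
      rw [Set.eq_empty_iff_forall_notMem]
      rintro x ⟨hx0, hxR⟩
      exact hx0 (by rw [hψT _ x (hpre R _ hi hxR).1, abs_zero])
    rw [this, measure_empty, mul_zero]
  have hνpos : ∀ s : ℝ, 0 < s → 0 < ν (ball (q, 0) s) := by
    intro s hs
    obtain ⟨l, hl⟩ := (hhalf.eventually (gt_mem_nhds (show 0 < s / 4 by positivity))).exists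
    have hδ : Tendsto (fun j : ℕ => 2 * (C ^ l + 1) * (1 / 2 : ℝ≥0) ^ j) atTop (𝓝 0) := by
      simpa using (NNReal.tendsto_pow_atTop_nhds_zero_of_lt_one
        (show (1 / 2 : ℝ≥0) < 1 from NNReal.half_lt_self one_ne_zero)).const_mul
          (2 * (C ^ l + 1))
    refine measure_ball_pos_of_vague_tendsto hν hs
      (c := (2 * ((C ^ l + 1 : ℝ≥0) : ℝ))⁻¹) (by positivity)
      (hρ.tendsto_atTop.eventually (hc s)) (hρ.tendsto_atTop.eventually
        (p := fun j => _ ≤ (μ j).real (ball (q, 0) (s / 2))) ?_)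
    filter_upwards [hhalf.eventually (gt_mem_nhds (show 0 < s / 12 by positivity)),
      hδ.eventually (ge_mem_nhds one_pos), hτ.tendsto_atTop.eventually_ge_atTop n,
      tendsto_natCast_atTop_atTop.eventually_ge_atTop (s / 2)] with j hj1s hj2s hjn hjs
    have hrad : (1 / 2 : ℝ) ^ (τ j + l) = (1 / 2) ^ l * t j := by rw [ht_def, pow_add, mul_comm]
    have hdbl := measure_ball_two_pow_mul_le (hd p hp) l (τ j + l) (by omega)
    have hrad2 : (2 : ℝ) ^ l * (1 / 2) ^ (τ j + l) = t j := by
      rw [hrad, ← mul_assoc, ← mul_pow]; norm_num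
    rw [hrad2, hrad] at hdbl
    have hBA : ball p ((1 / 2) ^ l * t j) ⊆ ball p (t j) :=
      ball_subset_ball (mul_le_of_le_one_left (ht j).le (hj2 l))
    have hAT : ball p (t j) ⊆ ball p (2 ^ j * t j) :=
      ball_subset_ball (le_mul_of_one_le_left (ht j).le (hj1 j))
    have hlow := inv_le_toReal_inv_mul_measure_inter (E := E) (hM0 j) (hMt j) hBA
      (D := C ^ l + 1) (hdbl.trans (by push_cast; gcongr; exact le_self_add))
      ((measure_mono (Set.sdiff_subset_sdiff_left hAT)).trans (hψE j)) hj2s (by positivity)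
    refine hlow.trans ?_
    rw [measureReal_def, hμ_apply j _ measurableSet_ball]
    refine ENNReal.toReal_mono (ENNReal.mul_ne_top (ENNReal.inv_ne_top.2 (hM0 j)) ?_) ?_
    · exact ne_top_of_le_ne_top (hbf p _).ne
        (measure_mono ((hpre _ j hjs).trans Set.inter_subset_right))
    · gcongr
      refine subset_trans ?_ ((inter_ball_subset_preimage_of_almost_isometry (s := (1 / 2) ^ l)
        (ht j) (hpT j) (hψp j) (hψd j)).trans (Set.preimage_mono (ball_subset_ball ?_)))
      · exact fun x hx => ⟨⟨hx.1, hAT (hBA hx.2)⟩, hx.2⟩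
      · linarith
  let shift : ℕ → ℕ := fun i => ρ (i + 2)
  have hshift : StrictMono shift := fun i i' h => hρ (by omega)
  have hshift2 : ∀ i, 2 ≤ shift i := fun i => by
    have := hρ.id_le (i + 2); simp only [id, shift] at this ⊢; omega
  refine ⟨fun i => t (shift i), fun i => ht _,
    hhalf_anti.comp_monotone (hτ.comp hshift).monotone,
    hhalf.comp (hτ.comp hshift).tendsto_atTop,
    { X := Y × ℝ, m := ν, p := (q, 0) }, fun x r => ?_, hνpos,
    fun i => 2 ^ shift i, fun i => 8 * (1 / 2) ^ shift i, fun i => ψ (shift i),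
    (pow_right_mono₀ (by norm_num)).comp hshift.monotone,
    htwo.comp hshift.tendsto_atTop,
    fun i i' h => mul_le_mul_of_nonneg_left (hhalf_anti (hshift.monotone h)) (by norm_num),
    by simpa using (hhalf.comp hshift.tendsto_atTop).const_mul 8,
    fun i => ⟨by positivity, ?_⟩, fun i => ?_, fun f hf _ hfb => ?_⟩
  · exact (measure_mono ball_subset_closedBall).trans_lt
      (isCompact_closedBall (α := Y × ℝ) x r).measure_lt_top
  · have h1 := hhalf_anti (hshift2 i)
    have h2 : (2 : ℝ) ^ 2 ≤ 2 ^ shift i := pow_le_pow_right₀ (by norm_num) (hshift2 i)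
    norm_num at h1 h2 ⊢
    linarith
  · beta_reduce
    generalize shift i = j
    have hη : (0 : ℝ) < (1 / 2) ^ j := by positivity
    refine ⟨hψm j, hψp j, T j, hE.inter measurableSet_ball, Set.inter_subset_right, hpT j,
      fun x hx y hy => ?_, ?_, ?_⟩
    · have := abs_le.1 (hψd j x hx y hy)
      constructor <;> linarith [this.1, this.2]
    · have hdiff : ball p (2 ^ j * t j) \ T j = ball p (2 ^ j * t j) \ E := by
        ext x
        simp only [hT_def, Set.mem_sdiff, Set.mem_inter_iff]
        tauto
      rw [hdiff]
      refine ENNReal.div_le_of_le_mul ((hψE j).trans ?_)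
      gcongr
      rw [← ENNReal.ofReal_coe_nnreal]
      refine ENNReal.ofReal_le_ofReal ?_
      push_cast
      linarith
    · refine le_of_eq_of_le (measure_mono_null ?_ hν0) zero_le
      rintro ⟨y, a⟩ ⟨hyR, hyT⟩ ha
      have ha0 : a = 0 := abs_eq_zero.1 ha
      subst ha0
      rw [mem_ball] at hyR
      change dist (y, (0 : ℝ)) (q, 0) < _ at hyR
      rw [dist_prod_same_right] at hyR
      obtain ⟨x, hx, hxy⟩ := hψs j y (by linarith)
      exact hyT (mem_thickening_iff.2 ⟨ψ j x, ⟨x, hx, rfl⟩, by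
        change dist (y, (0 : ℝ)) (ψ j x) < _
        linarith⟩)
  · exact (hν f hf (isCompact_of_isClosed_isBounded (isClosed_tsupport f) hfb.closure)).comp
      (tendsto_add_atTop_nat 2)
end
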